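/- arXiv:1911.12403 — 4 statements merged into one kernel-verified Lean document; each statement's English description precedes it below -/
import Mathlib

section
/- For every integer t with 5 ≤ t ≤ 14 and every integer ℓ ≥ 2, there exists an ℓt × t Vatican design. -/
/-- A uniform `n × t` crossover design: each row is a bijection `Fin t → Fin t`,
`t` divides `n`, and each treatment appears exactly `n / t` times in each column. -/
def IsUniformDesign (n t : ℕ) (D : Fin n → Fin t → Fin t) : Prop :=
  t ∣ n ∧ (∀ i : Fin n, Function.Bijective (D i)) ∧
  ∀ (j x : Fin t), Nat.card {i : Fin n // D i j = x} = n / t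

/-- `o_d(x, y)`: the number of pairs `(i, j)` with `j + d < t`, `D i j = x` and
`D i (j + d) = y`. -/
noncomputable def designPairCount (n t : ℕ) (D : Fin n → Fin t → Fin t) (d : ℕ) (x y : Fin t) : ℕ :=
  Nat.card {p : Fin n × Fin t //
    ∃ h : (p.2 : ℕ) + d < t, D p.1 p.2 = x ∧ D p.1 ⟨(p.2 : ℕ) + d, h⟩ = y}

/-- A Roman-`k` design: a uniform design with `o_d(x, y) ≤ n / t` for all
`1 ≤ d ≤ k` and all distinct treatments `x ≠ y`. -/
def IsRomanDesign (n t k : ℕ) (D : Fin n → Fin t → Fin t) : Prop :=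
  IsUniformDesign n t D ∧
  ∀ d : ℕ, 1 ≤ d → d ≤ k → ∀ x y : Fin t, x ≠ y → designPairCount n t D d x y ≤ n / t

/-- A Vatican design is a Roman-`(t - 1)` design. -/
def IsVaticanDesign (n t : ℕ) (D : Fin n → Fin t → Fin t) : Prop :=
  IsRomanDesign n t (t - 1) D

/-- A family of `ℓ` sequences over `ℤ/t`, each a permutation, in which every nonzero element
occurs at most `ℓ` times as a difference of two entries at any fixed positive distance. -/
def IsVaticanFamily {t : ℕ} [NeZero t] {ℓ : ℕ} (s : Fin ℓ → Fin t → Fin t) : Prop :=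
  (∀ i, Function.Injective (s i)) ∧
  ∀ d : Fin t, d ≠ 0 → ∀ x : Fin t, x ≠ 0 →
    ∑ i, (Finset.univ.filter fun j : Fin t =>
      ∃ h : (j : ℕ) + d < t, s i ⟨j + d, h⟩ - s i j = x).card ≤ ℓ

instance {t : ℕ} [NeZero t] {ℓ : ℕ} (s : Fin ℓ → Fin t → Fin t) :
    Decidable (IsVaticanFamily s) := by
  unfold IsVaticanFamily Function.Injective
  infer_instance

/-- There is a Vatican family of `ℓ` sequences over `ℤ/t`. -/
def HasVaticanFamily (t ℓ : ℕ) [NeZero t] : Prop :=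
  ∃ s : Fin ℓ → Fin t → Fin t, IsVaticanFamily s

namespace HasVaticanFamily

variable {t : ℕ} [NeZero t] {ℓ : ℕ}

theorem add {a b : ℕ} (ha : HasVaticanFamily t a) (hb : HasVaticanFamily t b) :
    HasVaticanFamily t (a + b) := by
  obtain ⟨r, hr, hr'⟩ := ha
  obtain ⟨s, hs, hs'⟩ := hb
  refine ⟨Fin.append r s, fun i => ?_, fun d hd x hx => ?_⟩
  · refine Fin.addCases (fun i => ?_) (fun i => ?_) i
    · simpa using hr i
    · simpa using hs i
  · simpa [Fin.sum_univ_add] using add_le_add (hr' d hd x hx) (hs' d hd x hx)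

theorem of_one (h1 : HasVaticanFamily t 1) (hℓ : 1 ≤ ℓ) : HasVaticanFamily t ℓ := by
  induction ℓ, hℓ using Nat.le_induction with
  | base => exact h1
  | succ n _ ih => exact ih.add h1

theorem of_two_of_three (h2 : HasVaticanFamily t 2) (h3 : HasVaticanFamily t 3) (hℓ : 2 ≤ ℓ) :
    HasVaticanFamily t ℓ := by
  induction ℓ using Nat.strong_induction_on with
  | _ n ih =>
    obtain rfl | rfl | hn : n = 2 ∨ n = 3 ∨ 4 ≤ n := by lia
    · exact h2
    · exact h3
    · have h := (ih (n - 2) (by lia) (by lia)).add h2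
      rwa [Nat.sub_add_cancel hℓ] at h

/-- Developing a Vatican family over `ℤ/t` yields a Vatican design. -/
theorem exists_isVaticanDesign (h : HasVaticanFamily t ℓ) :
    ∃ D : Fin (ℓ * t) → Fin t → Fin t, IsVaticanDesign (ℓ * t) t D := by
  obtain ⟨s, hs, hs'⟩ := h
  let e : Fin (ℓ * t) ≃ Fin ℓ × Fin t := finProdFinEquiv.symm
  have hdiv : ℓ * t / t = ℓ := Nat.mul_div_cancel _ (NeZero.pos t)
  refine ⟨fun n j => s (e n).1 j + (e n).2, ⟨dvd_mul_left t ℓ, fun n => ?_, fun j x => ?_⟩,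
    fun d hd hdt x y hxy => ?_⟩
  · exact Finite.injective_iff_bijective.mp fun a b hab => hs _ (add_right_cancel hab)
  · let f : {n : Fin (ℓ * t) // s (e n).1 j + (e n).2 = x} ≃ Fin ℓ :=
      { toFun := fun n => (e n).1
        invFun := fun i => ⟨e.symm (i, x - s i j), by simp⟩
        left_inv := by
          rintro ⟨n, rfl⟩
          simp
        right_inv := fun i => by simp }
    rw [Nat.card_congr f, hdiv, Nat.card_fin]
  · rw [hdiv]
    have hdt' : d < t := by have := NeZero.pos t; lia
    refine le_trans ?_ (hs' ⟨d, hdt'⟩ ?_ (y - x) (sub_ne_zero.mpr hxy.symm))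
    · rw [← Finset.card_sigma, ← Fintype.card_coe, ← Nat.card_eq_fintype_card, designPairCount]
      refine Nat.card_le_card_of_injective
        (fun p => ⟨⟨(e p.1.1).1, p.1.2⟩, ?_⟩) ?_
      · obtain ⟨p, h, rfl, rfl⟩ := p
        simpa using h
      · rintro ⟨⟨m, j⟩, h, hx, hy⟩ ⟨⟨n, k⟩, h', hx', hy'⟩ heq
        simp only [Subtype.mk.injEq, Sigma.mk.injEq, heq_eq_eq] at heq
        obtain ⟨hmn, rfl⟩ := heq
        dsimp only at hx hx'
        rw [← hx', hmn] at hx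
        have : m = n := e.injective (Prod.ext hmn (add_left_cancel hx))
        subst this
        rfl
    · intro h0
      have := congrArg Fin.val h0
      simp at this
      lia

end HasVaticanFamily

theorem vatican_design_of_small_t (t : ℕ) (ht5 : 5 ≤ t) (ht14 : t ≤ 14)
    (ℓ : ℕ) (hℓ : 2 ≤ ℓ) :
    ∃ D : Fin (ℓ * t) → Fin t → Fin t, IsVaticanDesign (ℓ * t) t D := by
  interval_cases t
  · have h2 : HasVaticanFamily 5 2 := ⟨![![0, 1, 3, 2, 4],
      ![0, 4, 2, 3, 1]], by decide +kernel⟩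
    have h3 : HasVaticanFamily 5 3 := ⟨![![0, 2, 3, 1, 4],
      ![0, 2, 1, 3, 4],
      ![0, 1, 4, 3, 2]], by decide +kernel⟩
    exact (h2.of_two_of_three h3 hℓ).exists_isVaticanDesign
  · have h1 : HasVaticanFamily 6 1 := ⟨![![0, 2, 1, 4, 5, 3]], by decide +kernel⟩
    exact (h1.of_one (by lia)).exists_isVaticanDesign
  · have h2 : HasVaticanFamily 7 2 := ⟨![![0, 1, 3, 6, 4, 5, 2],
      ![0, 6, 4, 1, 3, 2, 5]], by decide +kernel⟩
    have h3 : HasVaticanFamily 7 3 := ⟨![![0, 1, 3, 2, 5, 6, 4],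
      ![0, 2, 6, 4, 3, 5, 1],
      ![0, 4, 5, 1, 6, 3, 2]], by decide +kernel⟩
    exact (h2.of_two_of_three h3 hℓ).exists_isVaticanDesign
  · have h2 : HasVaticanFamily 8 2 := ⟨![![0, 1, 2, 5, 7, 3, 6, 4],
      ![0, 7, 6, 3, 1, 5, 2, 4]], by decide +kernel⟩
    have h3 : HasVaticanFamily 8 3 := ⟨![![0, 2, 1, 4, 6, 7, 5, 3],
      ![0, 4, 1, 6, 7, 3, 5, 2],
      ![0, 3, 2, 1, 5, 6, 4, 7]], by decide +kernel⟩
    exact (h2.of_two_of_three h3 hℓ).exists_isVaticanDesign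
  · have h2 : HasVaticanFamily 9 2 := ⟨![![0, 1, 4, 2, 7, 5, 6, 3, 8],
      ![0, 8, 5, 7, 2, 4, 3, 6, 1]], by decide +kernel⟩
    have h3 : HasVaticanFamily 9 3 := ⟨![![0, 2, 5, 1, 3, 7, 4, 8, 6],
      ![0, 8, 1, 6, 4, 5, 3, 2, 7],
      ![0, 3, 4, 7, 6, 1, 2, 8, 5]], by decide +kernel⟩
    exact (h2.of_two_of_three h3 hℓ).exists_isVaticanDesign
  · have h1 : HasVaticanFamily 10 1 := ⟨![![0, 1, 8, 2, 4, 9, 7, 3, 6, 5]], by decide +kernel⟩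
    exact (h1.of_one (by lia)).exists_isVaticanDesign
  · have h2 : HasVaticanFamily 11 2 := ⟨![![0, 1, 3, 6, 10, 7, 5, 4, 9, 2, 8],
      ![0, 10, 8, 5, 1, 4, 6, 7, 2, 9, 3]], by decide +kernel⟩
    have h3 : HasVaticanFamily 11 3 := ⟨![![0, 8, 9, 5, 4, 2, 7, 1, 3, 6, 10],
      ![0, 6, 1, 3, 4, 8, 7, 10, 9, 5, 2],
      ![0, 6, 4, 2, 3, 8, 1, 9, 5, 7, 10]], by decide +kernel⟩
    exact (h2.of_two_of_three h3 hℓ).exists_isVaticanDesign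
  · have h1 : HasVaticanFamily 12 1 := ⟨![![0, 1, 4, 2, 9, 5, 11, 3, 8, 10, 7, 6]], by decide +kernel⟩
    exact (h1.of_one (by lia)).exists_isVaticanDesign
  · have h2 : HasVaticanFamily 13 2 := ⟨![![0, 1, 3, 4, 9, 6, 10, 2, 8, 11, 7, 5, 12],
      ![0, 12, 10, 9, 4, 7, 3, 11, 5, 2, 6, 8, 1]], by decide +kernel⟩
    have h3 : HasVaticanFamily 13 3 := ⟨![![0, 1, 2, 3, 10, 4, 8, 7, 12, 5, 9, 11, 6],
      ![0, 3, 6, 9, 4, 12, 11, 8, 10, 2, 1, 7, 5],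
      ![0, 9, 5, 1, 12, 10, 7, 11, 4, 6, 3, 8, 2]], by decide +kernel⟩
    exact (h2.of_two_of_three h3 hℓ).exists_isVaticanDesign
  · have h2 : HasVaticanFamily 14 2 := ⟨![![0, 1, 5, 2, 8, 6, 12, 3, 10, 9, 11, 7, 4, 13],
      ![0, 13, 9, 12, 6, 8, 2, 11, 4, 5, 3, 7, 10, 1]], by decide +kernel⟩
    have h3 : HasVaticanFamily 14 3 := ⟨![![0, 1, 2, 3, 5, 13, 9, 12, 4, 11, 10, 6, 8, 7],
      ![0, 9, 4, 13, 3, 5, 11, 10, 8, 1, 6, 12, 2, 7],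
      ![0, 11, 8, 5, 13, 3, 1, 6, 2, 9, 12, 10, 4, 7]], by decide +kernel⟩
    exact (h2.of_two_of_three h3 hℓ).exists_isVaticanDesign
end

section
/- Let q be a prime with q ≡ 7 (mod 12) or q ≡ 5 (mod 24), and let t = 2q. Then for every positive integer ℓ there exists an ℓt × t Roman-2 design. -/
section DifferenceSequences

variable {G : Type*} [AddCommGroup G] [Fintype G]

/-- A listing `a 0, …, a (t - 1)` of a finite abelian group of order `t` whose differences
`a (j + d) - a j` are pairwise distinct for each `1 ≤ d ≤ k` develops into a Roman-`k` design
with `ℓ * t` subjects, for every `ℓ`. -/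
theorem exists_isRomanDesign_of_injOn_sub {t k ℓ : ℕ} (hG : Fintype.card G = t) (ht : 0 < t)
    (a : ℕ → G) (ha : ∀ i j, i < t → j < t → a i = a j → i = j)
    (hd : ∀ d, 1 ≤ d → d ≤ k → ∀ i j, i + d < t → j + d < t →
      a (i + d) - a i = a (j + d) - a j → i = j) :
    ∃ D : Fin (ℓ * t) → Fin t → Fin t, IsRomanDesign (ℓ * t) t k D := by
  have hdiv : ℓ * t / t = ℓ := Nat.mul_div_cancel _ ht
  let φ : G ≃ Fin t := Fintype.equivFinOfCardEq hG
  let ψ : Fin (ℓ * t) ≃ Fin ℓ × Fin t := finProdFinEquiv.symm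
  let D : Fin (ℓ * t) → Fin t → Fin t := fun i j => φ (φ.symm (ψ i).2 + a j)
  have hD : ∀ i j x, D i j = x ↔ φ.symm (ψ i).2 + a j = φ.symm x := fun i j x => by
    rw [Equiv.eq_symm_apply]
  refine ⟨D, ⟨⟨Dvd.intro_left _ rfl, fun i => ?_, fun j x => ?_⟩, fun d h1 hk x y _ => ?_⟩⟩
  · refine Finite.injective_iff_bijective.mp fun j j' h => ?_
    exact Fin.ext (ha _ _ j.2 j'.2 (add_left_cancel (φ.injective h)))
  · refine (Nat.card_eq_of_bijective (fun i : {i // D i j = x} => (ψ i.1).1)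
      ⟨fun i i' h => ?_, fun m => ?_⟩).trans ((Nat.card_fin ℓ).trans hdiv.symm)
    · have h2 := add_right_cancel (((hD _ _ _).mp i.2).trans ((hD _ _ _).mp i'.2).symm)
      exact Subtype.ext (ψ.injective (Prod.ext h (φ.symm.injective h2)))
    · exact ⟨⟨ψ.symm (m, φ (φ.symm x - a j)), by simp [hD]⟩, by simp⟩
  · refine (Nat.card_le_card_of_injective (β := Fin ℓ) (fun p => (ψ p.1.1).1)
      fun p p' h => ?_).trans ((Nat.card_fin ℓ).trans hdiv.symm).le
    obtain ⟨⟨i, j⟩, hj, hx, hy⟩ := p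
    obtain ⟨⟨i', j'⟩, hj', hx', hy'⟩ := p'
    simp only [hD] at hj hj' hx hx' hy hy' h
    have hjj : j = j' := by
      refine Fin.ext (hd d h1 hk _ _ hj hj' ?_)
      rw [← add_sub_add_left_eq_sub _ _ (φ.symm (ψ i).2), hx, hy,
        ← add_sub_add_left_eq_sub (a (↑j' + d)) _ (φ.symm (ψ i').2), hx', hy']
    subst hjj
    have h2 : (ψ i).2 = (ψ i').2 := φ.symm.injective (add_right_cancel (hx.trans hx'.symm))
    have : i = i' := ψ.injective (Prod.ext h h2)
    subst this
    rfl

end DifferenceSequences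

section Labels

/-- The even, `2 * q`-periodic function on `ℤ` that on `[-q, q]` is the indicator of
`|n| ≡ c (mod 8)`. -/
def periodicLabel (q c : ℕ) (n : ℤ) : ZMod 2 :=
  if (n.bmod (2 * q)).natAbs % 8 = c then 1 else 0

variable {q c : ℕ}

theorem periodicLabel_congr {m n : ℤ} (h : (2 * q : ℤ) ∣ m - n) :
    periodicLabel q c m = periodicLabel q c n := by
  unfold periodicLabel
  rw [(Int.bmod_eq_bmod_iff_bmod_sub_eq_zero).mpr (Int.bmod_eq_zero_of_dvd (by exact_mod_cast h))]

theorem periodicLabel_of_abs_le {n : ℤ} (h1 : -q ≤ n) (h2 : n ≤ q) (hq : 0 < q) :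
    periodicLabel q c n = if n.natAbs % 8 = c then 1 else 0 := by
  unfold periodicLabel
  rcases eq_or_lt_of_le h2 with rfl | h2
  · have : (q : ℤ).bmod (2 * q) = -q := by
      rw [Int.bmod_def]; push_cast
      rw [Int.emod_eq_of_lt (by omega) (by omega), if_neg (by omega)]; ring
    rw [this, Int.natAbs_neg]
  · rw [Int.bmod_eq_of_le (by push_cast; omega) (by push_cast; omega)]

theorem periodicLabel_neg (hq : 0 < q) (n : ℤ) :
    periodicLabel q c (-n) = periodicLabel q c n := by
  obtain ⟨m, hm, h1, h2⟩ : ∃ m : ℤ, (2 * q : ℤ) ∣ n - m ∧ -q ≤ m ∧ m ≤ q := by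
    refine ⟨n.bmod (2 * q), ?_, ?_, ?_⟩
    · exact_mod_cast Int.dvd_self_sub_bmod
    · have := Int.le_bmod (x := n) (m := 2 * q) (by omega); push_cast at this; omega
    · have := Int.bmod_lt (x := n) (m := 2 * q) (by omega); push_cast at this; omega
  rw [periodicLabel_congr hm, periodicLabel_congr (m := -n) (n := -m) (by
    rw [← neg_sub', dvd_neg]; exact hm), periodicLabel_of_abs_le h1 h2 hq,
    periodicLabel_of_abs_le (by omega) (by omega) hq, Int.natAbs_neg]

/-- The residue `c` modulo `8` that fits the modulus `q`. -/
def FitsModulus (q c : ℕ) : Prop :=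
  (q % 8 = 3 ∧ c = 5) ∨ ((q % 8 = 5 ∨ q % 8 = 7) ∧ c = 3)

theorem periodicLabel_add_four_of_pos (hc : FitsModulus q c) (hq : 5 ≤ q) {w : ℤ} (hw : 2 ∣ w)
    (h1 : 2 ≤ w) (h2 : w ≤ q - 3) :
    periodicLabel q c (w - 3) + periodicLabel q c (w + 3) ≠
      periodicLabel q c (w - 1) + periodicLabel q c (w + 1) := by
  rw [periodicLabel_of_abs_le (n := w - 3) (by omega) (by omega) (by omega),
    periodicLabel_of_abs_le (n := w + 3) (by omega) (by omega) (by omega),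
    periodicLabel_of_abs_le (n := w - 1) (by omega) (by omega) (by omega),
    periodicLabel_of_abs_le (n := w + 1) (by omega) (by omega) (by omega)]
  unfold FitsModulus at hc
  split_ifs <;> first | decide | (exfalso; omega)

theorem periodicLabel_middle (hc : FitsModulus q c) (hq : 5 ≤ q) :
    periodicLabel q c (q - 4) + periodicLabel q c (q + 2) ≠
      1 + periodicLabel q c 1 + periodicLabel q c 3 := by
  rw [periodicLabel_congr (m := q + 2) (n := 2 - q) ⟨1, by ring⟩,
    periodicLabel_of_abs_le (n := q - 4) (by omega) (by omega) (by omega),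
    periodicLabel_of_abs_le (n := 2 - q) (by omega) (by omega) (by omega),
    periodicLabel_of_abs_le (n := 1) (by omega) (by omega) (by omega),
    periodicLabel_of_abs_le (n := 3) (by omega) (by omega) (by omega)]
  unfold FitsModulus at hc
  split_ifs <;> first | decide | (exfalso; omega)

theorem periodicLabel_add_four (hc : FitsModulus q c) (hq : 5 ≤ q) {v w : ℤ} (hw : 2 ∣ w)
    (h1 : w ≠ 0) (h2 : -(q - 3) ≤ w) (h3 : w ≤ q - 3) (hv : (2 * q : ℤ) ∣ v - w) :
    periodicLabel q c (v - 3) + periodicLabel q c (v + 3) ≠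
      periodicLabel q c (w - 1) + periodicLabel q c (w + 1) := by
  rw [periodicLabel_congr (m := v - 3) (n := w - 3) (by convert hv using 1; ring),
    periodicLabel_congr (m := v + 3) (n := w + 3) (by convert hv using 1; ring)]
  rcases lt_or_gt_of_ne h1 with h | h
  · have := periodicLabel_add_four_of_pos hc hq (w := -w) (by omega) (by omega) (by omega)
    rw [show -w - 3 = -(w + 3) by ring, show -w + 3 = -(w - 3) by ring,
      show -w - 1 = -(w + 1) by ring, show -w + 1 = -(w - 1) by ring] at this
    simp only [periodicLabel_neg (show 0 < q by omega)] at this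
    rwa [add_comm, add_comm (periodicLabel q c (w - 1))]
  · exact periodicLabel_add_four_of_pos hc hq hw (by omega) h3

theorem periodicLabel_middle_of_dvd (hc : FitsModulus q c) (hq : 5 ≤ q) {v : ℤ}
    (hv : (2 * q : ℤ) ∣ v - (q - 1) ∨ (2 * q : ℤ) ∣ v + (q - 1)) :
    periodicLabel q c (v - 3) + periodicLabel q c (v + 3) ≠
      1 + periodicLabel q c 1 + periodicLabel q c 3 := by
  have key := periodicLabel_middle hc hq
  rcases hv with hv | hv
  · rwa [periodicLabel_congr (m := v - 3) (n := q - 4) (by convert hv using 1; ring),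
      periodicLabel_congr (m := v + 3) (n := q + 2) (by convert hv using 1; ring)]
  · rwa [periodicLabel_congr (m := v - 3) (n := -(q + 2)) (by convert hv using 1; ring),
      periodicLabel_congr (m := v + 3) (n := -(q - 4)) (by convert hv using 1; ring),
      periodicLabel_neg (by omega), periodicLabel_neg (by omega), add_comm]

end Labels

section IntegerDivisibility

theorem two_mul_dvd_of_odd {q : ℕ} {n : ℤ} (hodd : q % 2 = 1) (h : (q : ℤ) ∣ n) (h2 : 2 ∣ n) :
    (2 * q : ℤ) ∣ n := by
  refine IsCoprime.mul_dvd ?_ h2 h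
  exact_mod_cast (Nat.coprime_two_left.mpr (Nat.odd_iff.mpr hodd)).isCoprime

theorem eq_of_dvd_of_abs_lt {q : ℕ} {n : ℤ} (h : (q : ℤ) ∣ n) (h1 : -(3 * q) < n)
    (h2 : n < 3 * q) : n = -(2 * q) ∨ n = -q ∨ n = 0 ∨ n = q ∨ n = 2 * q := by
  obtain ⟨m, rfl⟩ := h
  have hm1 : -3 < m := by nlinarith
  have hm2 : m < 3 := by nlinarith
  interval_cases m <;> omega

end IntegerDivisibility

section TwistedSquares

/-- The map `k ↦ 3 * k ^ 2` on `[0, q)`, and `k ↦ k ^ 2` elsewhere, modulo `q`. -/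
def twistedSquare (q : ℕ) (k : ℤ) : ZMod q :=
  if 0 ≤ k ∧ k < q then 3 * (k : ZMod q) ^ 2 else (k : ZMod q) ^ 2

/-- The increment of the `ZMod 2` label accompanying the step from `twistedSquare q k` to
`twistedSquare q (k + 1)`. -/
def stepLabel (q c : ℕ) (k : ℤ) : ZMod 2 :=
  if 0 ≤ k ∧ k < q then 1 + periodicLabel q c (6 * k + 3) else periodicLabel q c (2 * k + 1)

variable {q c h : ℕ}

theorem stepLabel_inside {k : ℤ} (h0 : 0 ≤ k) (h1 : k < q) :
    stepLabel q c k = 1 + periodicLabel q c (6 * k + 3) := if_pos ⟨h0, h1⟩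

theorem stepLabel_outside {k : ℤ} (hk : k < 0 ∨ q ≤ k) :
    stepLabel q c k = periodicLabel q c (2 * k + 1) := if_neg (by omega)

theorem twistedSquare_inside {k : ℤ} (h0 : 0 ≤ k) (h1 : k ≤ q) :
    twistedSquare q k = 3 * (k : ZMod q) ^ 2 := by
  unfold twistedSquare
  split_ifs
  · rfl
  · obtain rfl : k = q := by omega
    simp

theorem twistedSquare_outside {k : ℤ} (hk : k ≤ 0 ∨ q ≤ k) :
    twistedSquare q k = (k : ZMod q) ^ 2 := by
  unfold twistedSquare
  split_ifs
  · obtain rfl : k = 0 := by omega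
    simp
  · rfl

theorem twistedSquare_sub_inside {k : ℤ} (h0 : 0 ≤ k) (h1 : k < q) :
    twistedSquare q (k + 1) - twistedSquare q k = ((6 * k + 3 : ℤ) : ZMod q) := by
  rw [twistedSquare_inside h0 h1.le, twistedSquare_inside (by omega) (by omega)]
  push_cast; ring

theorem twistedSquare_sub_outside {k : ℤ} (hk : k < 0 ∨ q ≤ k) :
    twistedSquare q (k + 1) - twistedSquare q k = ((2 * k + 1 : ℤ) : ZMod q) := by
  rw [twistedSquare_outside (by omega), twistedSquare_outside (by omega)]
  push_cast; ring

theorem eq_of_step_eq (hh : q = 2 * h + 1) (hcop : IsCoprime (q : ℤ) 12) {k l : ℤ}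
    (hk1 : -h ≤ k) (hk2 : k < q + h) (hl1 : -h ≤ l) (hl2 : l < q + h)
    (hsq : twistedSquare q (k + 1) - twistedSquare q k =
      twistedSquare q (l + 1) - twistedSquare q l)
    (hlab : stepLabel q c k = stepLabel q c l) : k = l := by
  wlog hkl : (0 ≤ k ∧ k < q) ∨ ¬ (0 ≤ l ∧ l < q) generalizing k l
  · exact (this hl1 hl2 hk1 hk2 hsq.symm hlab.symm (by tauto)).symm
  by_cases hk : 0 ≤ k ∧ k < q
  · rw [twistedSquare_sub_inside hk.1 hk.2] at hsq
    by_cases hl : 0 ≤ l ∧ l < q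
    · rw [twistedSquare_sub_inside hl.1 hl.2, ZMod.intCast_eq_intCast_iff_dvd_sub] at hsq
      have := eq_of_dvd_of_abs_lt (hcop.dvd_of_dvd_mul_left (z := l - k) (by
        convert hsq.mul_left 2 using 1; ring)) (by omega) (by omega)
      omega
    · rw [twistedSquare_sub_outside (by omega), eq_comm,
        ZMod.intCast_eq_intCast_iff_dvd_sub] at hsq
      rw [stepLabel_inside hk.1 hk.2, stepLabel_outside (by omega), periodicLabel_congr
        (two_mul_dvd_of_odd (by omega) hsq (by omega))] at hlab
      simp at hlab
  · have hl : ¬ (0 ≤ l ∧ l < q) := by tauto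
    rw [twistedSquare_sub_outside (by omega), twistedSquare_sub_outside (by omega),
      ZMod.intCast_eq_intCast_iff_dvd_sub] at hsq
    have := eq_of_dvd_of_abs_lt (hcop.dvd_of_dvd_mul_left (z := l - k) (by
      convert hsq.mul_left 6 using 1; ring)) (by omega) (by omega)
    omega

theorem twistedSquare_sub_two_inside {k : ℤ} (h0 : 0 ≤ k) (h1 : k < q - 1) :
    twistedSquare q (k + 2) - twistedSquare q k = ((2 * (6 * k + 6) : ℤ) : ZMod q) := by
  rw [twistedSquare_inside h0 (by omega), twistedSquare_inside (by omega) (by omega)]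
  push_cast; ring

theorem stepLabel_add_inside {k : ℤ} (h0 : 0 ≤ k) (h1 : k < q - 1) :
    stepLabel q c k + stepLabel q c (k + 1) =
      periodicLabel q c (6 * k + 6 - 3) + periodicLabel q c (6 * k + 6 + 3) := by
  rw [stepLabel_inside h0 (by omega), stepLabel_inside (by omega) (by omega)]
  rw [add_add_add_comm, show (1 + 1 : ZMod 2) = 0 from rfl, zero_add]
  congr 2 <;> ring

theorem exists_double_step_outside (hh : q = 2 * h + 1) (hq : 5 ≤ q) {k : ℤ} (hk1 : -h ≤ k)
    (hk2 : k < q + h - 1) (hk : k < 0 ∨ q - 1 ≤ k) :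
    ∃ w : ℤ, twistedSquare q (k + 2) - twistedSquare q k = ((2 * w : ℤ) : ZMod q) ∧
      ((k ≤ -2 ∧ w = 2 * (k + 1) ∨ q ≤ k ∧ w = 2 * (k + 1 - q)) ∧
        stepLabel q c k + stepLabel q c (k + 1) =
          periodicLabel q c (w - 1) + periodicLabel q c (w + 1) ∨
      (k = -1 ∧ w = 1 - q ∨ k = q - 1 ∧ w = q - 1) ∧
        stepLabel q c k + stepLabel q c (k + 1) =
          1 + periodicLabel q c 1 + periodicLabel q c 3) := by
  have hcases : k ≤ -2 ∨ k = -1 ∨ k = q - 1 ∨ q ≤ k := by omega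
  rcases hcases with hk | rfl | rfl | hk
  · refine ⟨2 * (k + 1), ?_, Or.inl ⟨Or.inl ⟨hk, rfl⟩, ?_⟩⟩
    · rw [twistedSquare_outside (by omega), twistedSquare_outside (by omega)]
      push_cast; ring
    · rw [stepLabel_outside (by omega), stepLabel_outside (by omega)]
      congr 2; ring
  · refine ⟨1 - q, ?_, Or.inr ⟨Or.inl ⟨rfl, rfl⟩, ?_⟩⟩
    · rw [twistedSquare_inside (by omega) (by omega), twistedSquare_outside (by omega)]
      push_cast
      rw [ZMod.natCast_self]; ring
    · rw [stepLabel_outside (by omega), stepLabel_inside (by omega) (by omega)]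
      norm_num
      rw [periodicLabel_neg (by omega)]
      ring
  · refine ⟨q - 1, ?_, Or.inr ⟨Or.inr ⟨rfl, rfl⟩, ?_⟩⟩
    · rw [twistedSquare_outside (by omega), twistedSquare_inside (by omega) (by omega)]
      push_cast
      rw [ZMod.natCast_self]; ring
    · rw [stepLabel_inside (by omega) (by omega), stepLabel_outside (by omega),
        periodicLabel_congr (m := 6 * ((q : ℤ) - 1) + 3) (n := -3) ⟨3, by ring⟩,
        periodicLabel_congr (m := 2 * ((q : ℤ) - 1 + 1) + 1) (n := 1) ⟨1, by ring⟩,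
        periodicLabel_neg (by omega)]
      ring
  · refine ⟨2 * (k + 1 - q), ?_, Or.inl ⟨Or.inr ⟨hk, rfl⟩, ?_⟩⟩
    · rw [twistedSquare_outside (by omega), twistedSquare_outside (by omega)]
      push_cast
      rw [ZMod.natCast_self]; ring
    · rw [stepLabel_outside (by omega), stepLabel_outside (by omega),
        periodicLabel_congr (m := 2 * k + 1) (n := 2 * (k + 1 - q) - 1) ⟨1, by ring⟩,
        periodicLabel_congr (m := 2 * (k + 1) + 1) (n := 2 * (k + 1 - q) + 1) ⟨1, by ring⟩]

theorem eq_of_double_step_eq (hh : q = 2 * h + 1) (hq : 5 ≤ q) (hcop : IsCoprime (q : ℤ) 12)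
    (hc : FitsModulus q c) {k l : ℤ}
    (hk1 : -h ≤ k) (hk2 : k < q + h - 1) (hl1 : -h ≤ l) (hl2 : l < q + h - 1)
    (hsq : twistedSquare q (k + 2) - twistedSquare q k =
      twistedSquare q (l + 2) - twistedSquare q l)
    (hlab : stepLabel q c k + stepLabel q c (k + 1) =
      stepLabel q c l + stepLabel q c (l + 1)) : k = l := by
  wlog hkl : (0 ≤ k ∧ k < q - 1) ∨ ¬ (0 ≤ l ∧ l < q - 1) generalizing k l
  · exact (this hl1 hl2 hk1 hk2 hsq.symm hlab.symm (by tauto)).symm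
  by_cases hk : 0 ≤ k ∧ k < q - 1
  · rw [twistedSquare_sub_two_inside hk.1 hk.2] at hsq
    by_cases hl : 0 ≤ l ∧ l < q - 1
    · rw [twistedSquare_sub_two_inside hl.1 hl.2, ZMod.intCast_eq_intCast_iff_dvd_sub] at hsq
      rw [show 2 * (6 * l + 6) - 2 * (6 * k + 6) = 12 * (l - k) by ring] at hsq
      have := eq_of_dvd_of_abs_lt (hcop.dvd_of_dvd_mul_left hsq) (by omega) (by omega)
      omega
    · obtain ⟨w, hw, hw'⟩ := exists_double_step_outside (c := c) hh hq hl1 hl2 (by omega)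
      rw [hw, eq_comm, ZMod.intCast_eq_intCast_iff_dvd_sub] at hsq
      rw [stepLabel_add_inside hk.1 hk.2] at hlab
      have hdvd : (2 * q : ℤ) ∣ 6 * k + 6 - w := by
        refine two_mul_dvd_of_odd (by omega) (hcop.dvd_of_dvd_mul_left ?_) (by omega)
        convert hsq.mul_left 6 using 1; ring
      rcases hw' with ⟨hw1, hw2⟩ | ⟨hw1, hw2⟩
      · exact absurd (hlab.trans hw2)
          (periodicLabel_add_four hc hq (by omega) (by omega) (by omega) (by omega) hdvd)
      · refine absurd (hlab.trans hw2) (periodicLabel_middle_of_dvd hc hq ?_)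
        rcases hw1 with ⟨_, rfl⟩ | ⟨_, rfl⟩
        · right; convert hdvd using 1; ring
        · left; exact hdvd
  · obtain ⟨v, hv, hv'⟩ := exists_double_step_outside (c := c) hh hq hk1 hk2 (by omega)
    obtain ⟨w, hw, hw'⟩ := exists_double_step_outside (c := c) hh hq hl1 hl2 (by omega)
    rw [hv, hw, ZMod.intCast_eq_intCast_iff_dvd_sub] at hsq
    have hdvd : (2 * q : ℤ) ∣ w - v := by
      refine two_mul_dvd_of_odd (by omega) (hcop.dvd_of_dvd_mul_left ?_) (by omega)
      convert hsq.mul_left 6 using 1; ring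
    have := eq_of_dvd_of_abs_lt (dvd_of_mul_left_dvd hdvd) (by omega) (by omega)
    omega

theorem eq_or_add_eq_of_twistedSquare_eq [Fact q.Prime] (hh : q = 2 * h + 1)
    (h3 : ¬ IsSquare (3 : ZMod q)) {k l : ℤ}
    (hk1 : -h ≤ k) (hk2 : k ≤ q + h) (hl1 : -h ≤ l) (hl2 : l ≤ q + h)
    (hsq : twistedSquare q k = twistedSquare q l) : k = l ∨ k + l = q := by
  wlog hkl : (0 ≤ k ∧ k < q) ∨ ¬ (0 ≤ l ∧ l < q) generalizing k l
  · have := this hl1 hl2 hk1 hk2 hsq.symm (by tauto)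
    omega
  have h3' : (3 : ZMod q) ≠ 0 := fun h0 => h3 (h0 ▸ ⟨0, by simp⟩)
  have hdvd : (k : ZMod q) ^ 2 = (l : ZMod q) ^ 2 → (q : ℤ) ∣ k - l ∨ (q : ℤ) ∣ k + l := by
    intro hsq
    simp only [← ZMod.intCast_zmod_eq_zero_iff_dvd]
    push_cast
    rw [sub_eq_zero, ← eq_neg_iff_add_eq_zero]
    exact sq_eq_sq_iff_eq_or_eq_neg.mp hsq
  by_cases hk : 0 ≤ k ∧ k < q
  · rw [twistedSquare_inside hk.1 hk.2.le] at hsq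
    by_cases hl : 0 ≤ l ∧ l < q
    · rw [twistedSquare_inside hl.1 hl.2.le] at hsq
      rcases hdvd (mul_left_cancel₀ h3' hsq) with hd | hd
      all_goals
        have := eq_of_dvd_of_abs_lt hd (by omega) (by omega)
        omega
    · rw [twistedSquare_outside (by omega)] at hsq
      by_cases hk0 : (k : ZMod q) = 0
      · have hl0 : (l : ZMod q) = 0 := by simpa [hk0] using hsq.symm
        have := eq_of_dvd_of_abs_lt ((ZMod.intCast_zmod_eq_zero_iff_dvd _ _).mp hk0)
          (by omega) (by omega)
        have := eq_of_dvd_of_abs_lt ((ZMod.intCast_zmod_eq_zero_iff_dvd _ _).mp hl0)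
          (by omega) (by omega)
        omega
      · refine absurd ⟨(l : ZMod q) / k, ?_⟩ h3
        field_simp
        exact hsq
  · have hl : ¬ (0 ≤ l ∧ l < q) := by tauto
    rw [twistedSquare_outside (by omega), twistedSquare_outside (by omega)] at hsq
    rcases hdvd hsq with hd | hd
    all_goals
      have := eq_of_dvd_of_abs_lt hd (by omega) (by omega)
      omega

theorem stepLabel_reflect (hq : 0 < q) (k : ℤ) : stepLabel q c (q - 1 - k) = stepLabel q c k := by
  by_cases hk : 0 ≤ k ∧ k < q
  · rw [stepLabel_inside hk.1 hk.2, stepLabel_inside (by omega) (by omega),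
      ← periodicLabel_neg hq (6 * k + 3)]
    congr 1
    exact periodicLabel_congr ⟨3, by ring⟩
  · rw [stepLabel_outside (by omega), stepLabel_outside (by omega),
      ← periodicLabel_neg hq (2 * k + 1)]
    exact periodicLabel_congr ⟨1, by ring⟩

theorem stepLabel_middle (hh : q = 2 * h + 1) (hc : FitsModulus q c) :
    stepLabel q c h = 1 := by
  rw [stepLabel_inside (by omega) (by omega),
    periodicLabel_congr (n := q) ⟨1, by rw [hh]; push_cast; ring⟩,
    periodicLabel_of_abs_le (by omega) le_rfl (by omega), if_neg, add_zero]
  unfold FitsModulus at hc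
  omega

/-- The sum of the first `j` step labels, starting from the step at `-h`. -/
def sumLabel (q c h j : ℕ) : ZMod 2 :=
  ∑ i ∈ Finset.range j, stepLabel q c ((i : ℤ) - h)

theorem sumLabel_succ (j : ℕ) :
    sumLabel q c h (j + 1) = sumLabel q c h j + stepLabel q c ((j : ℤ) - h) :=
  Finset.sum_range_succ _ _

theorem sumLabel_reflect (hh : q = 2 * h + 1) (hc : FitsModulus q c) {i j : ℕ}
    (hij : i + j + 1 = 2 * q) : sumLabel q c h i ≠ sumLabel q c h j := by
  wlog hle : j ≤ i generalizing i j
  · exact (this (by omega) (by omega)).symm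
  obtain ⟨m, rfl⟩ : ∃ m, i = q + m := Nat.exists_eq_add_of_le (by omega)
  suffices sumLabel q c h (q + m) = sumLabel q c h j + 1 by simp [this]
  clear hle
  induction m generalizing j with
  | zero =>
    obtain rfl : q = j + 1 := by omega
    rw [add_zero, sumLabel_succ, show (j : ℤ) - h = h by omega, stepLabel_middle hh hc]
  | succ m ih =>
    rw [← add_assoc, sumLabel_succ, ih (j := j + 1) (by omega), sumLabel_succ,
      ← stepLabel_reflect (by omega) ((j : ℤ) - h),
      show (q : ℤ) - 1 - (j - h) = ((q + m : ℕ) : ℤ) - h by omega, add_right_comm,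
      add_assoc _ _ (stepLabel _ _ _), CharTwo.add_self_eq_zero, add_zero]

end TwistedSquares

theorem not_isSquare_three_of_mod {q : ℕ} (hq : q.Prime) (hmod : q % 12 = 7 ∨ q % 24 = 5) :
    ¬ IsSquare (3 : ZMod q) := by
  have h2 : ¬ IsSquare (2 : ZMod 3) := by decide
  have := Fact.mk hq
  have : Fact (Nat.Prime 3) := ⟨Nat.prime_three⟩
  rw [show (3 : ZMod q) = ((3 : ℕ) : ZMod q) by norm_num]
  rcases hmod with hmod | hmod
  · rw [ZMod.exists_sq_eq_prime_iff_of_mod_four_eq_three (by omega) (by norm_num)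
      (by omega), not_not, (ZMod.natCast_eq_natCast_iff' q 1 3).mpr (by omega)]
    exact ⟨1, by simp⟩
  · rw [ZMod.exists_sq_eq_prime_iff_of_mod_four_eq_one (by omega) (by norm_num),
      (ZMod.natCast_eq_natCast_iff' q 2 3).mpr (by omega)]
    exact h2

theorem roman2_design_twice_prime (q : ℕ) (hq : Nat.Prime q)
    (hmod : q % 12 = 7 ∨ q % 24 = 5) (t : ℕ) (htq : t = 2 * q)
    (ℓ : ℕ) (hℓ : 0 < ℓ) :
    ∃ D : Fin (ℓ * t) → Fin t → Fin t, IsRomanDesign (ℓ * t) t 2 D := by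
  have hq5 : 5 ≤ q := by omega
  have := Fact.mk hq
  obtain ⟨h, hh⟩ : ∃ h, q = 2 * h + 1 := ⟨q / 2, by omega⟩
  obtain ⟨c, hc⟩ : ∃ c, FitsModulus q c := by
    by_cases h3 : q % 8 = 3
    · exact ⟨5, Or.inl ⟨h3, rfl⟩⟩
    · exact ⟨3, Or.inr ⟨by omega, rfl⟩⟩
  have hcop : IsCoprime (q : ℤ) 12 := by
    have : ¬ q ∣ 12 := fun hd => by
      have := Nat.le_of_dvd (by norm_num) hd
      interval_cases q <;> omega
    exact_mod_cast ((Nat.Prime.coprime_iff_not_dvd hq).mpr this).isCoprime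
  refine exists_isRomanDesign_of_injOn_sub (G := ZMod q × ZMod 2) ?_ (by omega)
    (fun j => (twistedSquare q ((j : ℤ) - h), sumLabel q c h j)) ?_ ?_
  · rw [Fintype.card_prod, ZMod.card, ZMod.card, htq, mul_comm]
  · intro i j hi hj hij
    obtain ⟨h1, h2⟩ := Prod.mk.inj hij
    rcases eq_or_add_eq_of_twistedSquare_eq hh (not_isSquare_three_of_mod hq hmod)
      (by omega) (by omega) (by omega) (by omega) h1 with h | h
    · omega
    · exact absurd h2 (sumLabel_reflect hh hc (by omega))
  · intro d hd1 hd2 i j hi hj hij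
    obtain ⟨h1, h2⟩ := Prod.mk.inj hij
    obtain rfl | rfl : d = 1 ∨ d = 2 := by omega
    · simp only [sumLabel_succ, add_sub_cancel_left] at h2
      have := eq_of_step_eq (k := i - h) (l := j - h) hh hcop (by omega) (by omega) (by omega)
        (by omega) (by convert h1 using 3 <;> push_cast <;> ring) h2
      omega
    · simp only [sumLabel_succ, add_assoc, add_sub_cancel_left] at h2
      have := eq_of_double_step_eq (k := i - h) (l := j - h) hh hq5 hcop hc (by omega)
        (by omega) (by omega) (by omega) (by convert h1 using 3 <;> push_cast <;> ring)
        (by convert h2 using 3 <;> push_cast <;> ring)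
      omega
end

section
/- For every composite integer t ≥ 4 and every positive integer ℓ, there exists an ℓt × t Roman design. -/
/-- A row-complete Latin square with rows indexed by `α` and symbols in `β`. -/
structure IsRowComplete {α β : Type*} {t : ℕ} (L : α → Fin t → β) : Prop where
  row : ∀ i, Function.Bijective (L i)
  col : ∀ j, Function.Bijective fun i => L i j
  pair : ∀ i i' (j j' : Fin t) (h : (j : ℕ) + 1 < t) (h' : (j' : ℕ) + 1 < t),
    L i j = L i' j' → L i ⟨j + 1, h⟩ = L i' ⟨j' + 1, h'⟩ → i = i' ∧ j = j'

theorem IsRowComplete.transport {α β α' β' : Type*} {t : ℕ} {L : α → Fin t → β}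
    (hL : IsRowComplete L) (e : α' ≃ α) (g : β ≃ β') :
    IsRowComplete fun i j => g (L (e i) j) where
  row i := g.bijective.comp (hL.row (e i))
  col j := g.bijective.comp ((hL.col j).comp e.bijective)
  pair i i' j j' h h' h1 h2 := by
    obtain ⟨h3, h4⟩ := hL.pair (e i) (e i') j j' h h' (g.injective h1) (g.injective h2)
    exact ⟨e.injective h3, h4⟩

/-- Stacking copies of a row-complete Latin square gives a Roman design. -/
theorem IsRowComplete.exists_isRomanDesign {t : ℕ} {L : Fin t → Fin t → Fin t}
    (hL : IsRowComplete L) (ht : 0 < t) (ℓ : ℕ) :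
    ∃ D : Fin (ℓ * t) → Fin t → Fin t, IsRomanDesign (ℓ * t) t 1 D := by
  have hdiv : ℓ * t / t = ℓ := Nat.mul_div_cancel _ ht
  let e : Fin (ℓ * t) ≃ Fin ℓ × Fin t := finProdFinEquiv.symm
  refine ⟨fun i => L (e i).2, ⟨Dvd.intro_left ℓ rfl, fun i => hL.row _, fun j x => ?_⟩, ?_⟩
  · rw [hdiv]
    obtain ⟨r, hr⟩ := (hL.col j).2 x
    have hcard : Nat.card (Fin ℓ) = ℓ := by simp
    refine (Nat.card_congr ⟨fun i => (e i.1).1, fun k => ⟨e.symm (k, r), by simpa using hr⟩, ?_, ?_⟩).trans hcard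
    · rintro ⟨i, hi⟩
      have h2 : (e i).2 = r := (hL.col j).1 (hi.trans hr.symm)
      ext1
      apply e.injective
      simp [← h2]
    · intro k
      simp
  · intro d hd1 hd2 x y _
    obtain rfl : d = 1 := le_antisymm hd2 hd1
    rw [hdiv, designPairCount]
    have hcard : Nat.card (Fin ℓ) = ℓ := by simp
    conv_rhs => rw [← hcard]
    refine Nat.card_le_card_of_injective (fun p => (e p.1.1).1) ?_
    rintro ⟨⟨i, j⟩, h, h1, h2⟩ ⟨⟨i', j'⟩, h', h1', h2'⟩ heq
    obtain ⟨h3, h4⟩ := hL.pair _ _ j j' h h' (h1.trans h1'.symm) (h2.trans h2'.symm)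
    have : i = i' := e.injective (Prod.ext heq h3)
    subst this h4
    rfl

theorem IsRowComplete.exists_isRomanDesign_of_card {α β : Type*} [Fintype α] [Fintype β] {t : ℕ}
    {L : α → Fin t → β} (hL : IsRowComplete L) (hα : Fintype.card α = t)
    (hβ : Fintype.card β = t) (ht : 0 < t) (ℓ : ℕ) :
    ∃ D : Fin (ℓ * t) → Fin t → Fin t, IsRomanDesign (ℓ * t) t 1 D :=
  (hL.transport (Fintype.equivFinOfCardEq hα).symm
    (Fintype.equivFinOfCardEq hβ)).exists_isRomanDesign ht ℓ

/-- The zigzag square `(i, j) ↦ i + s j`, with `s = 0, -1, 1, -2, 2, …`, is row-complete. -/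
theorem exists_isRowComplete_of_even {t : ℕ} (ht : 0 < t) (heven : Even t) :
    ∃ L : ZMod t → Fin t → ZMod t, IsRowComplete L := by
  have : NeZero t := ⟨ht.ne'⟩
  obtain ⟨m, rfl⟩ := heven
  set t := m + m with htm
  let s : ℕ → ℕ := fun j => if j % 2 = 0 then j / 2 else t - (j + 1) / 2
  let d : ℕ → ℕ := fun j => if j % 2 = 0 then t - (j + 1) else j + 1
  have hcast : ∀ a b : ℕ, a < t → b < t → (a : ZMod t) = b → a = b := fun a b ha hb h => by
    rwa [ZMod.natCast_eq_natCast_iff', Nat.mod_eq_of_lt ha, Nat.mod_eq_of_lt hb] at h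
  have hs : ∀ i j : ℕ, i < t → j < t → (s i : ZMod t) = s j → i = j := fun i j hi hj h => by
    have := hcast _ _ (by simp only [s]; split_ifs <;> omega) (by simp only [s]; split_ifs <;> omega) h
    simp only [s] at this
    split_ifs at this <;> omega
  have hd : ∀ j, j + 1 < t → (s (j + 1) : ZMod t) - s j = d j := fun j hj => by
    have h1 : s (j + 1) + t = d j + s j ∨ s (j + 1) = d j + s j := by
      simp only [s, d]; split_ifs <;> omega
    rw [sub_eq_iff_eq_add]
    rcases h1 with h1 | h1
    · have := congrArg (Nat.cast : ℕ → ZMod t) h1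
      simpa using this
    · exact_mod_cast congrArg (Nat.cast : ℕ → ZMod t) h1
  refine ⟨fun i j => i + (s j : ZMod t), ?_, ?_, ?_⟩
  · intro i
    rw [Fintype.bijective_iff_injective_and_card]
    exact ⟨fun a b h => Fin.ext (hs _ _ a.2 b.2 (add_left_cancel h)), by simp⟩
  · intro j
    exact (Equiv.addRight ((s j : ℕ) : ZMod t)).bijective
  · intro i i' j j' h h' h1 h2
    simp only at h1 h2
    have h3 : (s (j + 1) : ZMod t) - s j = s (j' + 1) - s j' := by
      linear_combination h2 - h1
    rw [hd _ h, hd _ h'] at h3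
    have h4 := hcast _ _ (by simp only [d]; split_ifs <;> omega)
      (by simp only [d]; split_ifs <;> omega) h3
    have h5 : (j : ℕ) = j' := by
      simp only [d] at h4
      split_ifs at h4 <;> omega
    obtain rfl : j = j' := Fin.ext h5
    exact ⟨add_right_cancel h1, rfl⟩

/-- The consecutive pairs of entries of a list. -/
def steps {P : Type*} (l : List P) : List (P × P) := l.zip l.tail

theorem steps_map_range'_append {P : Type*} (f : ℕ → P) (x : P) (l : List P) (a n : ℕ) :
    steps ((List.range' a (n + 1)).map f ++ x :: l) =
      (List.range' a n).map (fun k => (f k, f (k + 1))) ++ (f (a + n), x) :: steps (x :: l) := by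
  induction n generalizing a with
  | zero => simp [steps]
  | succ n ih =>
    have := ih (a + 1)
    rw [List.range'_succ, List.range'_succ (n := n)]
    rw [List.range'_succ] at this
    simp only [steps, List.map_cons, List.cons_append, List.tail_cons, List.zip_cons_cons] at this ⊢
    rw [this, List.range'_succ, add_right_comm, add_assoc]
    rfl

theorem steps_map_range' {P : Type*} (f : ℕ → P) (a n : ℕ) :
    steps ((List.range' a (n + 1)).map f) =
      (List.range' a n).map (fun k => (f k, f (k + 1))) := by
  induction n generalizing a with
  | zero => simp [steps]
  | succ n ih =>
    have := ih (a + 1)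
    rw [List.range'_succ, List.range'_succ (n := n)]
    rw [List.range'_succ] at this
    simp only [steps, List.map_cons, List.tail_cons, List.zip_cons_cons] at this ⊢
    rw [this, List.range'_succ]
    rfl

section Dihedral

variable {κ μ : ℕ}

/-- The invariant of a step under the twisted translation action `twist`: the change of the second
coordinate, together with the sum of the first coordinates if that change is `±1` and their
difference otherwise. -/
def stepClass (s : (ZMod κ × ZMod μ) × (ZMod κ × ZMod μ)) : ZMod μ × ZMod κ :=
  (s.2.2 - s.1.2,
    if s.2.2 - s.1.2 = 1 ∨ s.2.2 - s.1.2 = -1 then s.1.1 + s.2.1 else s.2.1 - s.1.1)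

/-- A step changes the second coordinate by `±1` exactly when it enters or leaves the fibre
over `0`. -/
def IsAdmissible (s : (ZMod κ × ZMod μ) × (ZMod κ × ZMod μ)) : Prop :=
  (s.1.2 = 0 ↔ s.2.2 = 0) ↔ ¬ (s.2.2 - s.1.2 = 1 ∨ s.2.2 - s.1.2 = -1)

instance : DecidablePred (IsAdmissible (κ := κ) (μ := μ)) := fun _ => by
  unfold IsAdmissible; infer_instance

/-- A Hamiltonian path of `ZMod κ × ZMod μ` with admissible steps of distinct classes. -/
structure IsStarter (κ μ : ℕ) (l : List (ZMod κ × ZMod μ)) : Prop where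
  nodup : l.Nodup
  length : l.length = κ * μ
  classes : ((steps l).map stepClass).Nodup
  admissible : ∀ s ∈ steps l, IsAdmissible s

/-- Translation, with the first coordinate of the translation negated on the fibre over `0`. -/
def twist (ρ p : ZMod κ × ZMod μ) : ZMod κ × ZMod μ :=
  ((if p.2 = 0 then -ρ.1 else ρ.1) + p.1, p.2 + ρ.2)

theorem twist_left_injective (p : ZMod κ × ZMod μ) : Function.Injective fun ρ => twist ρ p := by
  rintro ⟨r, a⟩ ⟨r', a'⟩ h
  simp only [twist, Prod.mk.injEq] at h
  obtain ⟨h1, h2⟩ := h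
  refine Prod.ext ?_ (add_left_cancel h2)
  split_ifs at h1
  · exact neg_injective (add_right_cancel h1)
  · exact add_right_cancel h1

theorem twist_right_injective (ρ : ZMod κ × ZMod μ) : Function.Injective (twist ρ) := by
  rintro ⟨z, v⟩ ⟨z', v'⟩ h
  simp only [twist, Prod.mk.injEq] at h
  obtain ⟨h1, h2⟩ := h
  obtain rfl := add_right_cancel h2
  exact Prod.ext (add_left_cancel h1) rfl

/-- The class of an admissible step can be read off from any of its translates. -/
theorem stepClass_twist {s : (ZMod κ × ZMod μ) × (ZMod κ × ZMod μ)} (hs : IsAdmissible s)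
    (ρ : ZMod κ × ZMod μ) : stepClass (twist ρ s.1, twist ρ s.2) = stepClass s := by
  obtain ⟨⟨z, v⟩, z', v'⟩ := s
  simp only [IsAdmissible] at hs
  simp only [stepClass, twist, add_sub_add_right_eq_sub, Prod.mk.injEq, true_and]
  split_ifs <;> first | (exfalso; tauto) | ring1

theorem IsStarter.isRowComplete [NeZero κ] [NeZero μ] {l : List (ZMod κ × ZMod μ)}
    (hl : IsStarter κ μ l) :
    IsRowComplete fun ρ (j : Fin (κ * μ)) => twist ρ (l[(j : ℕ)]'(by rw [hl.length]; exact j.2)) where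
  row ρ := by
    rw [Fintype.bijective_iff_injective_and_card]
    refine ⟨fun j j' h => Fin.ext ?_, by simp [ZMod.card]⟩
    exact (hl.nodup.getElem_inj_iff).1 (twist_right_injective ρ h)
  col j := by
    rw [← Finite.injective_iff_bijective]
    exact twist_left_injective _
  pair ρ ρ' j j' h h' h1 h2 := by
    have hlen := hl.length
    have hstep : ∀ k, k + 1 < κ * μ → k < (steps l).length := fun k hk => by
      simp only [steps, List.length_zip, List.length_tail, hlen]
      omega
    have hget : ∀ k (hk : k + 1 < κ * μ), (steps l)[k]'(hstep k hk) =
        (l[k]'(by omega), l[k + 1]'(by omega)) := fun k hk => by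
      simp [steps]
    have hcl : ∀ (ρ : ZMod κ × ZMod μ) k (hk : k + 1 < κ * μ),
        stepClass (twist ρ (l[k]'(by omega)), twist ρ (l[k + 1]'(by omega))) =
          ((steps l).map stepClass)[k]'(by simpa using hstep k hk) := fun ρ k hk => by
      rw [List.getElem_map, ← stepClass_twist (hl.admissible _ (List.getElem_mem _)) ρ, hget k hk]
    have hj : (j : ℕ) = j' := by
      refine (hl.classes.getElem_inj_iff).1 ((hcl ρ j h).symm.trans (Eq.trans ?_ (hcl ρ' j' h')))
      simp only at h1 h2
      rw [h1, h2]
    obtain rfl : j = j' := Fin.ext hj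
    exact ⟨twist_left_injective _ h1, rfl⟩

theorem IsStarter.exists_isRomanDesign [NeZero κ] [NeZero μ] {l : List (ZMod κ × ZMod μ)}
    (hl : IsStarter κ μ l) (ℓ : ℕ) :
    ∃ D : Fin (ℓ * (κ * μ)) → Fin (κ * μ) → Fin (κ * μ), IsRomanDesign (ℓ * (κ * μ)) (κ * μ) 1 D :=
  hl.isRowComplete.exists_isRomanDesign_of_card (by simp [ZMod.card]) (by simp [ZMod.card])
    (Nat.pos_of_neZero _) ℓ

end Dihedral

/-- The repeating part of `apexPath`. -/
def apexBlock (p j : ℕ) : ℕ → ℕ × ℤ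
  | 0 => (2 * p + 5 - 2 * j, 0)
  | 1 => (j, 1)
  | 2 => (2 * p + 3 - j, 1)
  | 3 => (2 * j, 0)
  | 4 => (p + 1 - j, -1)
  | _ => (p + 3 + j, -1)

/-- The final part of `apexPath`. -/
def apexTail (p : ℕ) : ℕ → ℕ × ℤ
  | 0 => (3, 0)
  | 1 => (p + 1, 1)
  | 2 => (2 * p + 4, 0)
  | 3 => (p + 2, -1)
  | 4 => (1, 0)
  | 5 => (2 * p + 4, 1)
  | 6 => (0, 1)
  | 7 => (2 * p + 3, 1)
  | 8 => (0, 0)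
  | 9 => (p + 2, 1)
  | 10 => (2 * p + 2, 0)
  | 11 => (0, -1)
  | _ => (2 * p + 4, -1)

/-- For `4 ≤ n < 6 * p + 19`, a Hamiltonian path of the fibres over `0` and `±1`, where `p` is
given by `κ = 2 * p + 5`. -/
def apexPath (p n : ℕ) : ℕ × ℤ :=
  if n < 6 * p + 6 then apexBlock p (n / 6) (n % 6) else apexTail p (n - (6 * p + 6))

theorem apexPath_block {p j r : ℕ} (hj : j < p + 1) (hr : r < 6) :
    apexPath p (6 * j + r) = apexBlock p j r := by
  have h1 : (6 * j + r) / 6 = j := by omega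
  have h2 : (6 * j + r) % 6 = r := by omega
  rw [apexPath, if_pos (by omega), h1, h2]

theorem apexPath_tail (p i : ℕ) : apexPath p (6 * p + 6 + i) = apexTail p i := by
  rw [apexPath, if_neg (by omega), Nat.add_sub_cancel_left]

theorem exists_apexPath_eq {p k : ℕ} (hk : k < 2 * p + 5) {v : ℤ} (hv : v = 0 ∨ v = 1 ∨ v = -1) :
    ∃ n, 4 ≤ n ∧ n < 6 * p + 19 ∧ apexPath p n = (k, v) := by
  have block : ∀ j r, j < p + 1 → r < 6 → 4 ≤ 6 * j + r → apexBlock p j r = (k, v) →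
      ∃ n, 4 ≤ n ∧ n < 6 * p + 19 ∧ apexPath p n = (k, v) := fun j r hj hr h4 h =>
    ⟨6 * j + r, h4, by omega, (apexPath_block hj hr).trans h⟩
  have tail : ∀ i, i < 13 → apexTail p i = (k, v) →
      ∃ n, 4 ≤ n ∧ n < 6 * p + 19 ∧ apexPath p n = (k, v) := fun i hi h =>
    ⟨6 * p + 6 + i, by omega, by omega, (apexPath_tail p i).trans h⟩
  rcases hv with rfl | rfl | rfl
  · obtain h | h | h | h | h | h | h : k = 0 ∨ k = 1 ∨ k = 3 ∨ k = 2 * p + 2 ∨ k = 2 * p + 4 ∨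
        (k % 2 = 0 ∧ 2 ≤ k ∧ k ≤ 2 * p) ∨ (k % 2 = 1 ∧ 5 ≤ k) := by omega
    · exact tail 8 (by omega) (by simp [apexTail, h])
    · exact tail 4 (by omega) (by simp [apexTail, h])
    · exact tail 0 (by omega) (by simp [apexTail, h])
    · exact tail 10 (by omega) (by simp [apexTail, h])
    · exact tail 2 (by omega) (by simp [apexTail, h])
    · exact block (k / 2) 3 (by omega) (by omega) (by omega) (by simp [apexBlock]; omega)
    · exact block ((2 * p + 5 - k) / 2) 0 (by omega) (by omega) (by omega)
        (by simp [apexBlock]; omega)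
  · obtain h | h | h | h | h | h | h : k = 0 ∨ k = p + 1 ∨ k = p + 2 ∨ k = 2 * p + 3 ∨
        k = 2 * p + 4 ∨ (1 ≤ k ∧ k ≤ p) ∨ (p + 3 ≤ k ∧ k ≤ 2 * p + 2) := by omega
    · exact tail 6 (by omega) (by simp [apexTail, h])
    · exact tail 1 (by omega) (by simp [apexTail, h])
    · exact tail 9 (by omega) (by simp [apexTail, h])
    · exact tail 7 (by omega) (by simp [apexTail, h])
    · exact tail 5 (by omega) (by simp [apexTail, h])
    · exact block k 1 (by omega) (by omega) (by omega) (by simp [apexBlock])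
    · exact block (2 * p + 3 - k) 2 (by omega) (by omega) (by omega) (by simp [apexBlock]; omega)
  · obtain h | h | h | h | h : k = 0 ∨ k = p + 2 ∨ k = 2 * p + 4 ∨
        (1 ≤ k ∧ k ≤ p + 1) ∨ (p + 3 ≤ k ∧ k ≤ 2 * p + 3) := by omega
    · exact tail 11 (by omega) (by simp [apexTail, h])
    · exact tail 3 (by omega) (by simp [apexTail, h])
    · exact tail 12 (by omega) (by simp [apexTail, h])
    · exact block (p + 1 - k) 4 (by omega) (by omega) (by omega) (by simp [apexBlock]; omega)
    · exact block (k - (p + 3)) 5 (by omega) (by omega) (by omega) (by simp [apexBlock]; omega)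

/-- A property of consecutive entries holds somewhere along `apexPath` if it holds within a block,
between two blocks, or in the tail. -/
theorem exists_apexPath_step {p : ℕ} {R : ℕ × ℤ → ℕ × ℤ → Prop}
    (h : (∃ j r, j < p + 1 ∧ r < 5 ∧ 4 ≤ 6 * j + r ∧ R (apexBlock p j r) (apexBlock p j (r + 1))) ∨
      (∃ j, j < p ∧ R (apexBlock p j 5) (apexBlock p (j + 1) 0)) ∨
      R (apexBlock p p 5) (apexTail p 0) ∨
      ∃ i, i < 12 ∧ R (apexTail p i) (apexTail p (i + 1))) :
    ∃ n, 4 ≤ n ∧ n < 6 * p + 18 ∧ R (apexPath p n) (apexPath p (n + 1)) := by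
  obtain ⟨j, r, hj, hr, h4, h⟩ | ⟨j, hj, h⟩ | h | ⟨i, hi, h⟩ := h
  · refine ⟨6 * j + r, h4, by omega, ?_⟩
    rwa [add_assoc, apexPath_block hj (by omega), apexPath_block hj (by omega)]
  · refine ⟨6 * j + 5, by omega, by omega, ?_⟩
    rwa [show 6 * j + 5 + 1 = 6 * (j + 1) + 0 by omega, apexPath_block (by omega) (by omega),
      apexPath_block (by omega) (by omega)]
  · refine ⟨6 * p + 5, by omega, by omega, ?_⟩
    rwa [show 6 * p + 5 + 1 = 6 * p + 6 + 0 by omega, apexPath_block (by omega) (by omega),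
      apexPath_tail]
  · refine ⟨6 * p + 6 + i, by omega, by omega, ?_⟩
    rwa [add_assoc (6 * p + 6), apexPath_tail, apexPath_tail]

theorem forall_apexPath_step {p : ℕ} {R : ℕ × ℤ → ℕ × ℤ → Prop}
    (h1 : ∀ j r, j < p + 1 → r < 5 → R (apexBlock p j r) (apexBlock p j (r + 1)))
    (h2 : ∀ j, R (apexBlock p j 5) (apexBlock p (j + 1) 0))
    (h3 : R (apexBlock p p 5) (apexTail p 0))
    (h4 : ∀ i, i < 12 → R (apexTail p i) (apexTail p (i + 1))) (n : ℕ) (hn : n < 6 * p + 18) :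
    R (apexPath p n) (apexPath p (n + 1)) := by
  have key : ¬ ∃ n, n < 6 * p + 18 ∧ ¬ R (apexPath p n) (apexPath p (n + 1)) := by
    rintro ⟨n, hn, h⟩
    obtain hc | hc | hc | hc : (n % 6 < 5 ∧ n < 6 * p + 6) ∨ (n % 6 = 5 ∧ n < 6 * p) ∨
        n = 6 * p + 5 ∨ 6 * p + 6 ≤ n := by omega
    · rw [show n = 6 * (n / 6) + n % 6 by omega, add_assoc, apexPath_block (by omega) (by omega),
        apexPath_block (by omega) (by omega)] at h
      exact h (h1 _ _ (by omega) (by omega))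
    · rw [show n = 6 * (n / 6) + 5 by omega,
        show 6 * (n / 6) + 5 + 1 = 6 * (n / 6 + 1) + 0 by omega,
        apexPath_block (by omega) (by omega), apexPath_block (by omega) (by omega)] at h
      exact h (h2 _)
    · rw [hc, show 6 * p + 5 + 1 = 6 * p + 6 + 0 by omega, apexPath_block (by omega) (by omega),
        apexPath_tail] at h
      exact h h3
    · rw [show n = 6 * p + 6 + (n - (6 * p + 6)) by omega, add_assoc (6 * p + 6), apexPath_tail,
        apexPath_tail] at h
      exact h (h4 _ (by omega))
  by_contra hcon
  exact key ⟨n, hn, hcon⟩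

theorem apexPath_step {p n : ℕ} (hn : n < 6 * p + 18) :
    ((apexPath p n).2 = 0 ∧ ((apexPath p (n + 1)).2 = 1 ∨ (apexPath p (n + 1)).2 = -1)) ∨
    (((apexPath p n).2 = 1 ∨ (apexPath p n).2 = -1) ∧ (apexPath p (n + 1)).2 = 0) ∨
    (((apexPath p n).2 = 1 ∨ (apexPath p n).2 = -1) ∧ (apexPath p (n + 1)).2 = (apexPath p n).2) := by
  refine forall_apexPath_step
    (R := fun x y => (x.2 = 0 ∧ (y.2 = 1 ∨ y.2 = -1)) ∨ ((x.2 = 1 ∨ x.2 = -1) ∧ y.2 = 0) ∨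
      ((x.2 = 1 ∨ x.2 = -1) ∧ y.2 = x.2)) (fun j r _ hr => ?_) (fun j => ?_) ?_ (fun i hi => ?_) n hn
  · interval_cases r <;> simp [apexBlock]
  · simp [apexBlock]
  · simp [apexBlock, apexTail]
  · interval_cases i <;> simp [apexTail]

theorem exists_apexPath_pos {p e : ℕ} (he : e < 2 * p + 5) :
    ∃ n, 4 ≤ n ∧ n < 6 * p + 18 ∧ (apexPath p (n + 1)).2 - (apexPath p n).2 = 1 ∧
      ((apexPath p n).1 + (apexPath p (n + 1)).1 = e ∨
        (apexPath p n).1 + (apexPath p (n + 1)).1 = e + (2 * p + 5)) := by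
  refine exists_apexPath_step (R := fun x y => y.2 - x.2 = 1 ∧
    (x.1 + y.1 = e ∨ x.1 + y.1 = e + (2 * p + 5))) ?_
  obtain h | h | h | h | h | h | h : e = 0 ∨ e = 1 ∨ e = p + 2 ∨ e = p + 3 ∨ e = p + 4 ∨
    (2 ≤ e ∧ e ≤ p + 1) ∨ (p + 5 ≤ e) := by omega
  · exact .inr <| .inr <| .inr ⟨4, by omega, by simp [apexTail]; omega⟩
  · exact .inr <| .inr <| .inl (by simp [apexTail, apexBlock]; omega)
  · exact .inr <| .inr <| .inr ⟨8, by omega, by simp [apexTail]; omega⟩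
  · exact .inr <| .inr <| .inr ⟨3, by omega, by simp [apexTail]; omega⟩
  · exact .inr <| .inr <| .inr ⟨0, by omega, by simp [apexTail]; omega⟩
  · exact .inr <| .inl ⟨p + 1 - e, by omega, by simp [apexBlock]; omega⟩
  · exact .inl ⟨2 * p + 5 - e, 0, by omega, by omega, by omega, by simp [apexBlock]; omega⟩

theorem exists_apexPath_neg {p e : ℕ} (he : e < 2 * p + 5) :
    ∃ n, 4 ≤ n ∧ n < 6 * p + 18 ∧ (apexPath p (n + 1)).2 - (apexPath p n).2 = -1 ∧
      ((apexPath p n).1 + (apexPath p (n + 1)).1 = e ∨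
        (apexPath p n).1 + (apexPath p (n + 1)).1 = e + (2 * p + 5)) := by
  refine exists_apexPath_step (R := fun x y => y.2 - x.2 = -1 ∧
    (x.1 + y.1 = e ∨ x.1 + y.1 = e + (2 * p + 5))) ?_
  obtain h | h | h | h | h | h | h | h : e + 2 ≤ p ∨ (e + 1 = p ∨ (p = 0 ∧ e = 4)) ∨ e = p ∨
    e = p + 1 ∨ (p + 2 ≤ e ∧ e ≤ 2 * p + 1) ∨ e = 2 * p + 2 ∨ e = 2 * p + 3 ∨
    (1 ≤ p ∧ e = 2 * p + 4) := by omega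
  · exact .inl ⟨e + 2, 2, by omega, by omega, by omega, by simp [apexBlock]; omega⟩
  · exact .inr <| .inr <| .inr ⟨9, by omega, by simp [apexTail]; omega⟩
  · exact .inr <| .inr <| .inr ⟨1, by omega, by simp [apexTail]; omega⟩
  · exact .inr <| .inr <| .inr ⟨2, by omega, by simp [apexTail]; omega⟩
  · exact .inl ⟨e - (p + 1), 3, by omega, by omega, by omega, by simp [apexBlock]; omega⟩
  · exact .inr <| .inr <| .inr ⟨10, by omega, by simp [apexTail]; omega⟩
  · exact .inr <| .inr <| .inr ⟨7, by omega, by simp [apexTail]; omega⟩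
  · exact .inl ⟨1, 2, by omega, by omega, by omega, by simp [apexBlock]; omega⟩

theorem exists_apexPath_zero {p e : ℕ} (h0 : 0 < e) (he : e < 2 * p + 5) :
    ∃ n, 4 ≤ n ∧ n < 6 * p + 18 ∧ (apexPath p (n + 1)).2 - (apexPath p n).2 = 0 ∧
      ((apexPath p (n + 1)).1 = (apexPath p n).1 + e ∨
        (apexPath p (n + 1)).1 + (2 * p + 5) = (apexPath p n).1 + e) := by
  refine exists_apexPath_step (R := fun x y => y.2 - x.2 = 0 ∧
    (y.1 = x.1 + e ∨ y.1 + (2 * p + 5) = x.1 + e)) ?_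
  obtain h | h | h | h | h : e = 1 ∨ e = 2 * p + 3 ∨ e = 2 * p + 4 ∨
    (e % 2 = 0 ∧ 2 ≤ e ∧ e ≤ 2 * p + 2) ∨ (e % 2 = 1 ∧ 3 ≤ e ∧ e ≤ 2 * p + 1) := by omega
  · exact .inr <| .inr <| .inr ⟨5, by omega, by simp [apexTail]; omega⟩
  · exact .inr <| .inr <| .inr ⟨6, by omega, by simp [apexTail]; omega⟩
  · exact .inr <| .inr <| .inr ⟨11, by omega, by simp [apexTail]; omega⟩
  · exact .inl ⟨(e - 2) / 2, 4, by omega, by omega, by omega, by simp [apexBlock]; omega⟩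
  · exact .inl ⟨(2 * p + 3 - e) / 2, 1, by omega, by omega, by omega, by simp [apexBlock]; omega⟩

theorem nodup_of_subset_toFinset {P : Type*} [DecidableEq P] {l : List P} {s : Finset P}
    (hs : s ⊆ l.toFinset) (hl : l.length ≤ s.card) : l.Nodup := by
  have h : l.length ≤ l.dedup.length := by
    rw [← List.card_toFinset]
    exact hl.trans (Finset.card_le_card hs)
  rw [← (List.dedup_sublist l).eq_of_length_le h]
  exact List.nodup_dedup l

section Apex

variable {κ μ p : ℕ} {c : ZMod κ} {b : ZMod μ}

/-- The image of `apexPath` in `ZMod κ × ZMod μ` under scaling by `c` and `b`. -/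
def apexPoint (p : ℕ) (c : ZMod κ) (b : ZMod μ) (n : ℕ) : ZMod κ × ZMod μ :=
  (c * ((apexPath p n).1 : ZMod κ), b * ((apexPath p n).2 : ZMod μ))

/-- The step of `apexPoint` starting at index `n`. -/
abbrev apexStep (p : ℕ) (c : ZMod κ) (b : ZMod μ) (n : ℕ) :
    (ZMod κ × ZMod μ) × (ZMod κ × ZMod μ) :=
  (apexPoint p c b n, apexPoint p c b (n + 1))

theorem exists_natCast_mul_eq [NeZero κ] (hc : IsUnit c) (z : ZMod κ) :
    ∃ k : ℕ, k < κ ∧ c * (k : ZMod κ) = z := by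
  obtain ⟨u, rfl⟩ := hc
  exact ⟨(↑u⁻¹ * z : ZMod κ).val, ZMod.val_lt _, by simp⟩

theorem exists_mul_intCast_eq (hb : b = 1 ∨ b = -1) {v : ZMod μ} (hv : v = 0 ∨ v = 1 ∨ v = -1) :
    ∃ w : ℤ, (w = 0 ∨ w = 1 ∨ w = -1) ∧ b * (w : ZMod μ) = v := by
  rcases hb with rfl | rfl <;> rcases hv with rfl | rfl | rfl
  exacts [⟨0, by simp, by simp⟩, ⟨1, by simp, by simp⟩, ⟨-1, by simp, by simp⟩,
    ⟨0, by simp, by simp⟩, ⟨-1, by simp, by simp⟩, ⟨1, by simp, by simp⟩]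

theorem apexPoint_nodup (hκ : κ = 2 * p + 5) (hc : IsUnit c) (hb : b = 1 ∨ b = -1)
    (h10 : (1 : ZMod μ) ≠ 0) (h11 : (1 : ZMod μ) ≠ -1) :
    ((List.range' 4 (6 * p + 15)).map (apexPoint p c b)).Nodup := by
  have : NeZero κ := ⟨by omega⟩
  refine nodup_of_subset_toFinset
    (s := (Finset.univ : Finset (ZMod κ)) ×ˢ ({0, 1, -1} : Finset (ZMod μ))) ?_ ?_
  · rintro ⟨z, v⟩ hzv
    simp only [Finset.mem_product, Finset.mem_univ, true_and, Finset.mem_insert,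
      Finset.mem_singleton] at hzv
    obtain ⟨k, hk, rfl⟩ := exists_natCast_mul_eq hc z
    obtain ⟨w, hw, rfl⟩ := exists_mul_intCast_eq hb hzv
    obtain ⟨n, hn4, hn, h⟩ := exists_apexPath_eq (p := p) (hκ ▸ hk) hw
    simp only [List.mem_toFinset, List.mem_map, List.mem_range'_1]
    exact ⟨n, ⟨hn4, by omega⟩, by simp [apexPoint, h]⟩
  · have h3 : ({0, 1, -1} : Finset (ZMod μ)).card = 3 := by
      rw [Finset.card_eq_three]
      exact ⟨0, 1, -1, h10.symm, by simpa [eq_comm] using h10, h11, rfl⟩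
    rw [Finset.card_product, h3, Finset.card_univ, ZMod.card, List.length_map, List.length_range']
    omega

theorem apexPoint_snd {n : ℕ} (hb : b = 1 ∨ b = -1) (hn : n < 6 * p + 19) :
    (apexPoint p c b n).2 = 0 ∨ (apexPoint p c b n).2 = 1 ∨ (apexPoint p c b n).2 = -1 := by
  have h : (apexPath p n).2 = 0 ∨ (apexPath p n).2 = 1 ∨ (apexPath p n).2 = -1 := by
    by_cases hn' : n < 6 * p + 18
    · have := apexPath_step hn'
      tauto
    · obtain rfl : n = 6 * p + 6 + 12 := by omega
      simp [apexPath_tail, apexTail]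
  simp only [apexPoint]
  rcases hb with rfl | rfl <;> rcases h with h | h | h <;> simp [h]

theorem apexStep_isAdmissible {n : ℕ} (hb : b = 1 ∨ b = -1) (h10 : (1 : ZMod μ) ≠ 0)
    (hn : n < 6 * p + 18) : IsAdmissible (apexStep p c b n) := by
  simp only [IsAdmissible, apexPoint]
  have h01 : (0 : ZMod μ) ≠ -1 := fun h => h10 (by simpa using congrArg Neg.neg h.symm)
  rcases hb with rfl | rfl <;>
    rcases apexPath_step hn with ⟨h, h' | h'⟩ | ⟨h | h, h'⟩ | ⟨h | h, h'⟩ <;>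
    simp [h, h', h10, h10.symm, h01]

theorem apexStep_class_fst {n : ℕ} (hb : b = 1 ∨ b = -1) (hn : n < 6 * p + 18) :
    (stepClass (apexStep p c b n)).1 = 0 ∨ (stepClass (apexStep p c b n)).1 = 1 ∨
      (stepClass (apexStep p c b n)).1 = -1 := by
  simp only [stepClass, apexPoint]
  rcases hb with rfl | rfl <;>
    rcases apexPath_step hn with ⟨h, h' | h'⟩ | ⟨h | h, h'⟩ | ⟨h | h, h'⟩ <;>
    simp [h, h']

theorem apexStep_class_nodup (hκ : κ = 2 * p + 5) (hc : IsUnit c) (hb : b = 1 ∨ b = -1)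
    (h10 : (1 : ZMod μ) ≠ 0) (h11 : (1 : ZMod μ) ≠ -1) :
    ((List.range' 4 (6 * p + 14)).map fun n => stepClass (apexStep p c b n)).Nodup := by
  have : NeZero κ := ⟨by omega⟩
  have h01 : (0 : ZMod μ) ≠ -1 := fun h => h10 (by simpa using congrArg Neg.neg h.symm)
  refine nodup_of_subset_toFinset (s := (({0, 1, -1} : Finset (ZMod μ)) ×ˢ
    (Finset.univ : Finset (ZMod κ))).erase (0, 0)) ?_ ?_
  · rintro ⟨v, z⟩ hzv
    simp only [Finset.mem_erase, Finset.mem_product, Finset.mem_univ, and_true, Finset.mem_insert,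
      Finset.mem_singleton, ne_eq, Prod.mk.injEq, not_and] at hzv
    obtain ⟨hne, hv⟩ := hzv
    obtain ⟨e, he, rfl⟩ := exists_natCast_mul_eq hc z
    have hκ0 : ((2 * p + 5 : ℕ) : ZMod κ) = 0 := by rw [← hκ]; exact ZMod.natCast_self κ
    have cast_eq : ∀ x y : ℕ, (x = y ∨ x = y + (2 * p + 5)) → (x : ZMod κ) = y := by
      rintro x y (rfl | rfl)
      · rfl
      · rw [Nat.cast_add, hκ0, add_zero]
    simp only [List.mem_toFinset, List.mem_map, List.mem_range'_1, stepClass, Prod.mk.injEq]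
    have sub_eq : ∀ n, (apexPoint p c b (n + 1)).2 - (apexPoint p c b n).2 =
        b * (((apexPath p (n + 1)).2 - (apexPath p n).2 : ℤ) : ZMod μ) := fun n => by
      simp only [apexPoint]; push_cast; ring
    by_cases hv0 : v = 0
    · subst hv0
      have he0 : 0 < e := by
        rcases Nat.eq_zero_or_pos e with rfl | h
        · exact absurd (by simp) (hne rfl)
        · exact h
      obtain ⟨n, hn4, hn, h1, h2⟩ := exists_apexPath_zero (p := p) he0 (hκ ▸ he)
      refine ⟨n, ⟨hn4, by omega⟩, ?_, ?_⟩
      · rw [sub_eq, h1]; simp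
      · rw [sub_eq, h1, if_neg (by simp [h10.symm, h01])]
        have := cast_eq ((apexPath p n).1 + e) (apexPath p (n + 1)).1 (by omega)
        push_cast at this
        simp only [apexPoint]
        linear_combination -c * this
    · have hv' : v = 1 ∨ v = -1 := by tauto
      obtain ⟨w, hw, rfl⟩ := exists_mul_intCast_eq hb hv
      have hex : ∃ n, 4 ≤ n ∧ n < 6 * p + 18 ∧ (apexPath p (n + 1)).2 - (apexPath p n).2 = w ∧
          ((apexPath p n).1 + (apexPath p (n + 1)).1 = e ∨
          (apexPath p n).1 + (apexPath p (n + 1)).1 = e + (2 * p + 5)) := by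
        rcases hw with rfl | rfl | rfl
        · simp at hv0
        · exact exists_apexPath_pos (hκ ▸ he)
        · exact exists_apexPath_neg (hκ ▸ he)
      obtain ⟨n, hn4, hn, h1, h2⟩ := hex
      refine ⟨n, ⟨hn4, by omega⟩, ?_, ?_⟩
      · rw [sub_eq, h1]
      · rw [sub_eq, h1, if_pos hv']
        have := cast_eq _ _ h2
        push_cast at this
        simp only [apexPoint]
        linear_combination c * this
  · have h3 : ({0, 1, -1} : Finset (ZMod μ)).card = 3 := by
      rw [Finset.card_eq_three]
      exact ⟨0, 1, -1, h10.symm, by simpa [eq_comm] using h10, h11, rfl⟩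
    rw [Finset.card_erase_of_mem (by simp), Finset.card_product, h3, Finset.card_univ, ZMod.card,
      List.length_map, List.length_range']
    omega

theorem isStarter_apexPoint (p : ℕ) :
    IsStarter (2 * p + 5) 3 ((List.range' 4 (6 * p + 15)).map (apexPoint p 1 1)) where
  nodup := apexPoint_nodup rfl isUnit_one (.inl rfl) (by decide) (by decide)
  length := by simp; omega
  classes := by
    rw [steps_map_range', List.map_map]
    exact apexStep_class_nodup rfl isUnit_one (.inl rfl) (by decide) (by decide)
  admissible := by
    rw [steps_map_range']
    intro s hs
    simp only [List.mem_map, List.mem_range'_1] at hs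
    obtain ⟨n, hn, rfl⟩ := hs
    exact apexStep_isAdmissible (.inl rfl) (by decide) (by omega)

end Apex

/-- A cyclic sequence of period `N` avoiding `0` and `±1`, whose entries are distinct and whose
consecutive differences are distinct and also avoid `0` and `±1`. -/
structure IsMacro (μ N : ℕ) (f : ℕ → ZMod μ) : Prop where
  periodic : ∀ k, f (k + N) = f k
  inj : ∀ i j, f i = f j → i % N = j % N
  ne : ∀ k, ¬ (f k = 0 ∨ f k = 1 ∨ f k = -1)
  diff_inj : ∀ i j, f (i + 1) - f i = f (j + 1) - f j → i % N = j % N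
  diff_ne : ∀ k, ¬ (f (k + 1) - f k = 0 ∨ f (k + 1) - f k = 1 ∨ f (k + 1) - f k = -1)

theorem IsMacro.rotate {μ N : ℕ} {f : ℕ → ZMod μ} (hf : IsMacro μ N f) (a : ℕ) :
    IsMacro μ N fun k => f (k + a) where
  periodic k := by rw [add_right_comm, hf.periodic]
  inj i j h := Nat.ModEq.add_right_cancel' a (hf.inj _ _ h)
  ne k := hf.ne _
  diff_inj i j h := by
    simp only [add_right_comm _ 1 a] at h
    exact Nat.ModEq.add_right_cancel' a (hf.diff_inj _ _ h)
  diff_ne k := by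
    simp only [add_right_comm _ 1 a]
    exact hf.diff_ne _

/-- The multiplier of the number of completed turns in `macroPoint`. -/
def macroCoeff (κ m n : ℕ) : ZMod κ := if (n + m) % 2 = 0 then 2 else 1

/-- The lift of a cyclic sequence of period `N` to `ZMod κ × ZMod μ`, the first coordinate
depending on the number of completed turns. -/
def macroPoint {μ : ℕ} (κ N m : ℕ) (f : ℕ → ZMod μ) (n : ℕ) : ZMod κ × ZMod μ :=
  (macroCoeff κ m n * ((n / N : ℕ) : ZMod κ), f n)

section Macro

variable {κ μ N m : ℕ} {f : ℕ → ZMod μ}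

theorem macroCoeff_congr {i j : ℕ} (h : i % 2 = j % 2) : macroCoeff κ m i = macroCoeff κ m j := by
  have : (i + m) % 2 = (j + m) % 2 := by omega
  simp only [macroCoeff, this]

theorem macroCoeff_self : macroCoeff κ m m = 2 := by
  rw [macroCoeff, if_pos (by omega)]

theorem macroCoeff_of_odd {n : ℕ} (h : (n + m) % 2 = 1) : macroCoeff κ m n = 1 := by
  rw [macroCoeff, if_neg (by omega)]

theorem isUnit_two_of_odd (hκ : Odd κ) : IsUnit (2 : ZMod κ) := by
  simpa using (ZMod.isUnit_iff_coprime 2 κ).2 (Nat.coprime_two_left.2 hκ)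

theorem isUnit_macroCoeff (hκ : Odd κ) (n : ℕ) : IsUnit (macroCoeff κ m n) := by
  unfold macroCoeff
  split_ifs
  exacts [isUnit_two_of_odd hκ, isUnit_one]

theorem isUnit_macroCoeff_sub (n : ℕ) : IsUnit (macroCoeff κ m (n + 1) - macroCoeff κ m n) := by
  unfold macroCoeff
  split_ifs
  · omega
  · norm_num
  · norm_num
  · omega

theorem natCast_inj_of_lt {i j : ℕ} (hi : i < κ) (hj : j < κ) (h : (i : ZMod κ) = j) : i = j := by
  rwa [ZMod.natCast_eq_natCast_iff', Nat.mod_eq_of_lt hi, Nat.mod_eq_of_lt hj] at h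

theorem eq_of_mod_eq_of_div_eq {i j : ℕ} (h1 : i % N = j % N) (h2 : i / N = j / N) : i = j := by
  rw [← Nat.div_add_mod i N, ← Nat.div_add_mod j N, h1, h2]

theorem mod_two_of_mod (hN : Even N) {i j : ℕ} (h : i % N = j % N) : i % 2 = j % 2 :=
  Nat.ModEq.of_dvd hN.two_dvd h

theorem macroPoint_injOn (hf : IsMacro μ N f) (hκ : Odd κ) (hN : Even N) (h0 : 0 < N) {i j : ℕ}
    (hi : i < κ * N) (hj : j < κ * N) (h : macroPoint κ N m f i = macroPoint κ N m f j) :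
    i = j := by
  simp only [macroPoint, Prod.mk.injEq] at h
  have h1 := hf.inj _ _ h.2
  rw [macroCoeff_congr (mod_two_of_mod hN h1)] at h
  exact eq_of_mod_eq_of_div_eq h1 (natCast_inj_of_lt ((Nat.div_lt_iff_lt_mul h0).2 hi)
    ((Nat.div_lt_iff_lt_mul h0).2 hj) ((isUnit_macroCoeff hκ j).mul_left_cancel h.1))

theorem stepClass_eq {x y : ZMod κ × ZMod μ} (h : ¬ (y.2 - x.2 = 1 ∨ y.2 - x.2 = -1)) :
    stepClass (x, y) = (y.2 - x.2, y.1 - x.1) := by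
  rw [stepClass, if_neg h]

/-- The class of the step of `macroPoint` starting at index `n`. -/
abbrev macroClass {μ : ℕ} (κ N m : ℕ) (f : ℕ → ZMod μ) (n : ℕ) : ZMod μ × ZMod κ :=
  stepClass (macroPoint κ N m f n, macroPoint κ N m f (n + 1))

theorem macroClass_eq (hf : IsMacro μ N f) (n : ℕ) :
    macroClass κ N m f n = (f (n + 1) - f n, (macroPoint κ N m f (n + 1)).1 -
      (macroPoint κ N m f n).1) :=
  stepClass_eq fun h => hf.diff_ne n (.inr h)

theorem macroPoint_fst_sub (h0 : 0 < N) (n : ℕ) :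
    (macroPoint κ N m f (n + 1)).1 - (macroPoint κ N m f n).1 =
      (macroCoeff κ m (n + 1) - macroCoeff κ m n) * ((n / N : ℕ) : ZMod κ) +
        if n % N + 1 = N then macroCoeff κ m (n + 1) else 0 := by
  simp only [macroPoint]
  have hlt := Nat.mod_lt n h0
  have hn := Nat.div_add_mod n N
  split_ifs with h
  · have : (n + 1) / N = n / N + 1 := by
      rw [← hn, add_assoc, h, ← Nat.mul_succ, Nat.mul_div_cancel_left _ h0, hn]
    rw [this]
    push_cast
    ring
  · have : (n + 1) / N = n / N := by
      calc (n + 1) / N = (N * (n / N) + (n % N + 1)) / N := by rw [← add_assoc, hn]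
        _ = n / N := by
          rw [Nat.mul_add_div h0, Nat.div_eq_of_lt (a := n % N + 1) (by omega), add_zero]
    rw [this]
    ring

theorem macroClass_injOn (hf : IsMacro μ N f) (hN : Even N) (h0 : 0 < N) {i j : ℕ}
    (hi : i < κ * N) (hj : j < κ * N) (h : macroClass κ N m f i = macroClass κ N m f j) :
    i = j := by
  rw [macroClass_eq hf, macroClass_eq hf, Prod.mk.injEq, macroPoint_fst_sub h0,
    macroPoint_fst_sub h0] at h
  have h1 := hf.diff_inj _ _ h.1
  have h2 := mod_two_of_mod hN h1
  have h3 := h.2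
  rw [h1, macroCoeff_congr h2, macroCoeff_congr (i := i + 1) (j := j + 1) (by omega)] at h3
  exact eq_of_mod_eq_of_div_eq h1 (natCast_inj_of_lt ((Nat.div_lt_iff_lt_mul h0).2 hi)
    ((Nat.div_lt_iff_lt_mul h0).2 hj)
    ((isUnit_macroCoeff_sub j).mul_left_cancel (add_right_cancel h3)))

theorem steps_map_range'_append_map_range' {P : Type*} (f g : ℕ → P) (l : List P) (a n b k : ℕ) :
    steps ((List.range' a (n + 1)).map f ++ ((List.range' b (k + 1)).map g ++ l)) =
      (List.range' a n).map (fun i => (f i, f (i + 1))) ++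
        (f (a + n), g b) :: steps ((List.range' b (k + 1)).map g ++ l) := by
  simp only [List.range'_succ (s := b), List.map_cons, List.cons_append]
  rw [steps_map_range'_append]

theorem splice_perm {P : Type*} (T R : ℕ → P) (s n k a e : ℕ) :
    ((List.range' s n).map T ++ R k :: ((List.range' 0 k).map R ++ T (s + n) ::
      ((List.range' (k + a + 2) e).map R ++ R (k + a + 1) ::
        ((List.range' (k + 1) a).map R ++ [R (k + a + e + 2)])))).Perm
      ((List.range' s (n + 1)).map T ++ (List.range' 0 (k + a + e + 3)).map R) := by
  classical
  have h : List.range' 0 (k + a + e + 3) = List.range' 0 k ++ (k :: (List.range' (k + 1) a ++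
      ((k + a + 1) :: (List.range' (k + a + 2) e ++ [k + a + e + 2])))) := by
    have h1 := List.range'_append_1 (s := 0) (m := k) (n := a + e + 3)
    have h2 := List.range'_append_1 (s := k + 1) (m := a) (n := e + 2)
    have h3 := List.range'_append_1 (s := k + a + 2) (m := e) (n := 1)
    rw [show k + a + e + 3 = k + (a + e + 3) by ring, ← h1, show a + e + 3 = a + (e + 2) + 1 by ring,
      List.range'_succ, zero_add, ← h2, List.range'_succ, show k + 1 + a = k + a + 1 by ring,
      ← h3]
    simp [add_comm, add_left_comm, add_assoc]
  rw [List.perm_iff_count]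
  intro x
  simp only [h, List.range'_1_concat, List.map_append, List.map_cons, List.map_nil,
    List.count_append, List.count_cons, List.count_nil]
  omega

theorem splice_perm' {P : Type*} (T R : ℕ → P) (s n k a e : ℕ) :
    ((List.range' s n).map T ++ ((List.range' 0 (k + 1)).map R ++
      ((List.range' (k + a + 2) (e + 1)).map R ++
        ((List.range' (k + 1) (a + 1)).map R ++ [T (s + n)])))).Perm
      ((List.range' s (n + 1)).map T ++ (List.range' 0 (k + a + e + 3)).map R) := by
  refine List.Perm.trans ?_ (splice_perm T R s n k a e)
  classical
  rw [List.perm_iff_count]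
  intro x
  simp only [List.range'_1_concat, List.map_append, List.map_cons, List.map_nil,
    List.count_append, List.count_cons, List.count_nil, zero_add, show k + 1 + a = k + a + 1 by ring,
    show k + a + 2 + e = k + a + e + 2 by ring]
  omega

end Macro

section Join

variable {κ μ N m : ℕ} {f : ℕ → ZMod μ}

theorem isAdmissible_of_ne {x y : ZMod κ × ZMod μ} (hx : x.2 ≠ 0) (hy : y.2 ≠ 0)
    (h : ¬ (y.2 - x.2 = 1 ∨ y.2 - x.2 = -1)) : IsAdmissible (x, y) :=
  iff_of_true (iff_of_false hx hy) h

theorem nodup_append_of_forall {P : Type*} {l l' : List P} (s : P → Prop) (hl : l.Nodup)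
    (hl' : l'.Nodup) (h : ∀ x ∈ l, s x) (h' : ∀ x ∈ l', ¬ s x) : (l ++ l').Nodup :=
  hl.append hl' fun x hx hx' => h' x hx' (h x hx)

/-- A Hamiltonian path over the fibres of `0` and `±1` can be joined with the lift of a cyclic
sequence covering the other fibres. -/
theorem IsMacro.exists_isStarter {p : ℕ} {b : ZMod μ} (hf : IsMacro μ N f) (hκ : κ = 2 * p + 5)
    (hμ : μ = N + 3) (hN : Even N) (hm0 : 0 < m) (hm : m + 1 < N) (hb : b = 1 ∨ b = -1)
    (hp : f (N - 1) = f (m - 1) + f (m + 1) - f m) (hq : f 0 = b + f (m + 1) - f m) :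
    ∃ l, IsStarter κ μ l := by
  have hodd : Odd κ := ⟨p + 2, by omega⟩
  have hN0 : 0 < N := by omega
  have h10 : (1 : ZMod μ) ≠ 0 := by
    have : Fact (1 < μ) := ⟨by omega⟩
    exact one_ne_zero
  have h11 : (1 : ZMod μ) ≠ -1 := by
    have : Fact (2 < μ) := ⟨by omega⟩
    exact (ZMod.neg_one_ne_one).symm
  have h01 : (-1 : ZMod μ) ≠ 0 := neg_ne_zero.2 h10
  obtain ⟨t, ht, htc⟩ : ∃ t : ℕ, (t = 1 ∨ t = 2) ∧ macroCoeff κ m (N - 1) = t := by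
    unfold macroCoeff
    split_ifs
    exacts [⟨2, .inr rfl, by simp⟩, ⟨1, .inl rfl, by simp⟩]
  have h2 := isUnit_two_of_odd hodd
  have hc : IsUnit (-2 * t : ZMod κ) := by
    rcases ht with rfl | rfl
    · simpa using h2
    · simpa using h2.neg.mul h2
  have hb' : -b = 1 ∨ -b = -1 := by
    rcases hb with rfl | rfl <;> simp
  have hb0 : b ≠ 0 := by
    rcases hb with rfl | rfl <;> assumption
  obtain ⟨a, ha⟩ : ∃ a, t * N = a + 2 := ⟨t * N - 2, by rcases ht with rfl | rfl <;> omega⟩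
  obtain ⟨e, he⟩ : ∃ e, κ * N = m + a + e + 3 := by
    refine ⟨κ * N - (m + a + 3), ?_⟩
    have : 5 * N ≤ κ * N := Nat.mul_le_mul_right _ (by omega)
    rcases ht with rfl | rfl <;> omega
  set T := apexPoint p (-2 * t : ZMod κ) (-b) with hT
  set R := macroPoint κ N m f with hR
  have hlast : ((2 * p + 4 : ℕ) : ZMod κ) = -1 := by
    rw [eq_neg_iff_add_eq_zero, hκ]
    exact_mod_cast ZMod.natCast_self (2 * p + 5)
  have hT17 : T (4 + (6 * p + 13)) = (0, b) := by
    have := apexPath_tail p 11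
    rw [show 6 * p + 6 + 11 = 4 + (6 * p + 13) by ring] at this
    simp [hT, apexPoint, this, apexTail]
  have hT18 : T (4 + (6 * p + 14)) = (2 * (t : ZMod κ), b) := by
    have := apexPath_tail p 12
    rw [show 6 * p + 6 + 12 = 4 + (6 * p + 14) by ring] at this
    have h12 : apexTail p 12 = (2 * p + 4, -1) := rfl
    simp only [hT, apexPoint, this, h12, hlast]
    simp
  have hTc : stepClass (T (4 + (6 * p + 13)), T (4 + (6 * p + 13) + 1)) = (0, 2 * (t : ZMod κ)) := by
    rw [add_assoc (4 : ℕ), hT17, hT18, stepClass_eq] <;> simp [h10.symm, h01.symm]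
  have hdiv : ∀ i r, r < N → (i * N + r) / N = i := fun i r hr => by
    rw [mul_comm, Nat.mul_add_div hN0, Nat.div_eq_of_lt hr, add_zero]
  have hper : ∀ i r, f (i * N + r) = f r := fun i r => by
    induction i with
    | zero => simp
    | succ i ih => rw [Nat.succ_mul, add_right_comm, hf.periodic, ih]
  have hRv : ∀ i r, r < N → R (i * N + r) = (macroCoeff κ m r * i, f r) := fun i r hr => by
    have h3 : (i * N + r) % 2 = r % 2 := by
      obtain ⟨x, rfl⟩ := hN
      rw [show i * (x + x) + r = r + 2 * (i * x) by ring, Nat.add_mul_mod_self_left]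
    simp only [hR, macroPoint]
    rw [hdiv i r hr, hper, macroCoeff_congr h3]
  have hRv0 : ∀ r, r < N → R r = (0, f r) := fun r hr => by
    have := hRv 0 r hr
    simpa using this
  have hcm1 : macroCoeff κ m (m - 1) = 1 := macroCoeff_of_odd (by omega)
  have hR1 : R (m + a + 2) = (2 * (t : ZMod κ), f m) := by
    have := hRv t m (by omega)
    rwa [ha, macroCoeff_self, show a + 2 + m = m + a + 2 by ring] at this
  have hR2 : R (m + a + 1) = ((t : ZMod κ), f (m - 1)) := by
    have := hRv t (m - 1) (by omega)
    rwa [ha, hcm1, one_mul, show a + 2 + (m - 1) = m + a + 1 by omega] at this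
  have hR3 : R (m + a + e + 2) = (-(t : ZMod κ), f (N - 1)) := by
    have := hRv (κ - 1) (N - 1) (by omega)
    have h3 : (κ - 1) * N + (N - 1) = m + a + e + 2 := by
      have : (κ - 1) * N + N = κ * N := by
        rw [← Nat.succ_mul]
        congr 1
        omega
      omega
    rw [h3, htc, Nat.cast_sub (by omega)] at this
    simpa using this
  have hR4 : R (m + a + e + 3) = (0, f 0) := by
    have := hRv κ 0 hN0
    rw [add_zero, he] at this
    simpa using this
  have hdf := hf.diff_ne
  have hj1 : stepClass (T (4 + (6 * p + 13)), R 0) = macroClass κ N m f m := by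
    have hd : f 0 - b = f (m + 1) - f m := by rw [hq]; ring
    rw [macroClass_eq hf, hT17, hRv0 0 hN0, ← hR, hRv0 _ hm, hRv0 m (by omega), stepClass_eq] <;>
      simp only [hd]
    exact fun h => hdf m (.inr h)
  have hj2 : stepClass (R m, R (m + a + 2)) =
      stepClass (T (4 + (6 * p + 13)), T (4 + (6 * p + 13) + 1)) := by
    rw [hTc, hR1, hRv0 m (by omega), stepClass_eq] <;> simp [h10.symm, h01.symm]
  have hj3 : stepClass (R (m + a + e + 2), R (m + 1)) = macroClass κ N m f (m + a + 1) := by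
    have hd : f (m + 1) - f (N - 1) = f m - f (m - 1) := by rw [hp]; ring
    have hd' := hdf (m - 1)
    rw [show m - 1 + 1 = m by omega] at hd'
    have h3 : f (m + a + 1 + 1) - f (m + a + 1) = f m - f (m - 1) := by
      have h4 := congrArg Prod.snd hR1
      have h5 := congrArg Prod.snd hR2
      simp only [hR, macroPoint] at h4 h5
      rw [← h4, ← h5]
    rw [macroClass_eq hf, ← hR, show m + a + 1 + 1 = m + a + 2 by ring, hR1, hR2, hR3, hRv0 _ hm,
      stepClass_eq] <;> simp only [hd]
    · refine Prod.ext (h3.symm) ?_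
      simp only
      ring
    · exact fun h => hd' (.inr h)
  have hj4 : stepClass (R (m + a + 1), T (4 + (6 * p + 14))) =
      macroClass κ N m f (m + a + e + 2) := by
    have hd : b - f (m - 1) = f 0 - f (N - 1) := by rw [hp, hq]; ring
    have hd' := hdf (N - 1)
    have h4 := hf.periodic 0
    rw [zero_add] at h4
    rw [show N - 1 + 1 = N by omega, h4] at hd'
    have h3 : f (m + a + e + 2 + 1) - f (m + a + e + 2) = f 0 - f (N - 1) := by
      have h4 := congrArg Prod.snd hR4
      have h5 := congrArg Prod.snd hR3
      simp only [hR, macroPoint] at h4 h5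
      rw [← h4, ← h5]
    rw [macroClass_eq hf, ← hR, show m + a + e + 2 + 1 = m + a + e + 3 by ring, hR2, hR3, hR4, hT18,
      stepClass_eq] <;> simp only [hd]
    · refine Prod.ext (h3.symm) ?_
      simp only
      ring
    · exact fun h => hd' (.inr h)
  set l : List (ZMod κ × ZMod μ) := (List.range' 4 (6 * p + 14)).map T ++
    ((List.range' 0 (m + 1)).map R ++ ((List.range' (m + a + 2) (e + 1)).map R ++
        ((List.range' (m + 1) (a + 1)).map R ++ [T (4 + (6 * p + 14))]))) with hl
  have hsteps : steps l = (List.range' 4 (6 * p + 13)).map (fun i => (T i, T (i + 1))) ++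
      (T (4 + (6 * p + 13)), R 0) :: ((List.range' 0 m).map (fun i => (R i, R (i + 1))) ++
      (R m, R (m + a + 2)) ::
      ((List.range' (m + a + 2) e).map (fun i => (R i, R (i + 1))) ++
        (R (m + a + e + 2), R (m + 1)) ::
        ((List.range' (m + 1) a).map (fun i => (R i, R (i + 1))) ++
          [(R (m + a + 1), T (4 + (6 * p + 14)))]))) := by
    rw [hl, steps_map_range'_append_map_range', steps_map_range'_append_map_range',
      steps_map_range'_append_map_range', steps_map_range'_append, zero_add,
      show m + a + 2 + e = m + a + e + 2 by ring, show m + 1 + a = m + a + 1 by ring]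
    rfl
  have hclass : ((steps l).map stepClass).Perm
      ((List.range' 4 (6 * p + 14)).map (fun n => stepClass (apexStep p (-2 * t : ZMod κ) (-b) n)) ++
        (List.range' 0 (κ * N)).map (macroClass κ N m f)) := by
    rw [hsteps, he]
    simp only [List.map_append, List.map_cons, List.map_nil, List.map_map, hj1, hj2, hj3, hj4]
    exact splice_perm (fun n => stepClass (apexStep p (-2 * t : ZMod κ) (-b) n))
      (macroClass κ N m f) 4 (6 * p + 13) m a e
  have hvert : l.Perm ((List.range' 4 (6 * p + 15)).map T ++ (List.range' 0 (κ * N)).map R) := by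
    rw [he]
    exact splice_perm' T R 4 (6 * p + 14) m a e
  refine ⟨l, ?_, ?_, ?_, ?_⟩
  · rw [hvert.nodup_iff]
    refine nodup_append_of_forall (fun x => x.2 = 0 ∨ x.2 = 1 ∨ x.2 = -1)
      (apexPoint_nodup hκ hc hb' h10 h11) ?_ ?_ ?_
    · refine List.Nodup.map_on (fun i hi j hj h => ?_) List.nodup_range'
      rw [List.mem_range'_1] at hi hj
      exact macroPoint_injOn hf hodd hN hN0 (by omega) (by omega) h
    · intro x hx
      obtain ⟨n, hn, rfl⟩ := List.mem_map.1 hx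
      rw [List.mem_range'_1] at hn
      exact apexPoint_snd hb' (by omega)
    · intro x hx
      obtain ⟨n, hn, rfl⟩ := List.mem_map.1 hx
      exact hf.ne n
  · have : κ * μ = κ * N + κ * 3 := by rw [hμ, mul_add]
    simp only [hvert.length_eq, List.length_append, List.length_map, List.length_range']
    omega
  · rw [hclass.nodup_iff]
    refine nodup_append_of_forall (fun x => x.1 = 0 ∨ x.1 = 1 ∨ x.1 = -1)
      (apexStep_class_nodup hκ hc hb' h10 h11) ?_ ?_ ?_
    · refine List.Nodup.map_on (fun i hi j hj h => ?_) List.nodup_range'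
      rw [List.mem_range'_1] at hi hj
      exact macroClass_injOn hf hN hN0 (by omega) (by omega) h
    · intro x hx
      obtain ⟨n, hn, rfl⟩ := List.mem_map.1 hx
      rw [List.mem_range'_1] at hn
      exact apexStep_class_fst hb' (by omega)
    · intro x hx
      obtain ⟨n, hn, rfl⟩ := List.mem_map.1 hx
      rw [macroClass_eq hf]
      exact hdf n
  · have hf0 : ∀ n, f n ≠ 0 := fun n h => hf.ne n (.inl h)
    have hRa : ∀ n, IsAdmissible (R n, R (n + 1)) := fun n =>
      isAdmissible_of_ne (hf0 _) (hf0 _) fun h => hdf n (.inr h)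
    have hadm : ∀ x y : ZMod κ × ZMod μ, x.2 ≠ 0 → y.2 ≠ 0 →
        (∃ n, stepClass (x, y) = macroClass κ N m f n) → IsAdmissible (x, y) := by
      rintro x y hx hy ⟨n, h⟩
      rw [macroClass_eq hf, Prod.ext_iff] at h
      refine isAdmissible_of_ne hx hy fun h' => hdf n (.inr ?_)
      have h1 : y.2 - x.2 = f (n + 1) - f n := h.1
      rwa [← h1]
    intro s hs
    rw [hsteps] at hs
    simp only [List.mem_append, List.mem_cons, List.mem_map, List.mem_range'_1, List.not_mem_nil,
      or_false] at hs
    rcases hs with ⟨n, hn, rfl⟩ | rfl | ⟨n, -, rfl⟩ | rfl | ⟨n, -, rfl⟩ | rfl | ⟨n, -, rfl⟩ | rfl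
    · exact apexStep_isAdmissible hb' h10 (by omega)
    · exact hadm _ _ (by rw [hT17]; exact hb0) (hf0 _) ⟨_, hj1⟩
    · exact hRa n
    · refine isAdmissible_of_ne (hf0 _) (hf0 _) ?_
      rw [hR1, hRv0 m (by omega)]
      simp [h10.symm, h01.symm]
    · exact hRa n
    · exact hadm _ _ (hf0 _) (hf0 _) ⟨_, hj3⟩
    · exact hRa n
    · exact hadm _ _ (hf0 _) (by rw [hT18]; exact hb0) ⟨_, hj4⟩

end Join

section Zigzag

variable {κ μ N : ℕ} {g : ℕ → ℕ}

theorem isMacro_of_lift {d : ℕ → ℕ} (hN : 0 < N) (hg : ∀ k < N, 2 ≤ g k ∧ g k + 2 ≤ μ)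
    (hg_inj : ∀ i < N, ∀ j < N, g i = g j → i = j) (hd : ∀ k < N, 2 ≤ d k ∧ d k + 2 ≤ μ)
    (hd_inj : ∀ i < N, ∀ j < N, d i = d j → i = j)
    (hgd : ∀ k < N, g ((k + 1) % N) = g k + d k ∨ g ((k + 1) % N) + μ = g k + d k) :
    IsMacro μ N fun k => (g (k % N) : ZMod μ) := by
  have hlt : ∀ k, k % N < N := fun k => Nat.mod_lt k hN
  have hne : ∀ v, 2 ≤ v ∧ v + 2 ≤ μ →
      ¬ ((v : ZMod μ) = 0 ∨ (v : ZMod μ) = 1 ∨ (v : ZMod μ) = -1) := by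
    rintro v ⟨hv1, hv2⟩ (h | h | h)
    · have := natCast_inj_of_lt (κ := μ) (i := v) (j := 0) (by omega) (by omega) (by simpa using h)
      omega
    · have := natCast_inj_of_lt (κ := μ) (i := v) (j := 1) (by omega) (by omega) (by simpa using h)
      omega
    · have := natCast_inj_of_lt (κ := μ) (i := v + 1) (j := 0) (by omega) (by omega) (by simp [h])
      omega
  have hdiff : ∀ k, (g ((k + 1) % N) : ZMod μ) - g (k % N) = d (k % N) := fun k => by
    have h := hgd _ (hlt k)
    rw [Nat.mod_add_mod] at h
    rw [sub_eq_iff_eq_add']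
    rcases h with h | h
    · exact_mod_cast congrArg (Nat.cast : ℕ → ZMod μ) h
    · have := congrArg (Nat.cast : ℕ → ZMod μ) h
      simpa using this
  refine ⟨fun k => by simp, fun i j h => ?_, fun k => hne _ (hg _ (hlt k)), fun i j h => ?_,
    fun k => ?_⟩
  · have h1 := hg _ (hlt i)
    have h2 := hg _ (hlt j)
    exact hg_inj _ (hlt i) _ (hlt j) (natCast_inj_of_lt (by omega) (by omega) h)
  · rw [hdiff, hdiff] at h
    have h1 := hd _ (hlt i)
    have h2 := hd _ (hlt j)
    exact hd_inj _ (hlt i) _ (hlt j) (natCast_inj_of_lt (by omega) (by omega) h)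
  · rw [hdiff]
    exact hne _ (hd _ (hlt k))

/-- `IsMacro.exists_isStarter` with the cyclic sequence cut between `i` and `i + 1`. -/
theorem exists_isStarter_of_lift (hg : IsMacro μ N fun k => (g (k % N) : ZMod μ)) {p i j m : ℕ}
    {b c c' : ℤ} (hκ : κ = 2 * p + 5) (hμ : μ = N + 3) (hN : Even N) (hm0 : 0 < m) (hm : m + 1 < N)
    (hi : i + 1 < N) (hj : j + 2 < N) (hij : m + i = j ∨ m + i = j + N) (hb : b = 1 ∨ b = -1)
    (hp : (g i : ℤ) + g (j + 1) = g j + g (j + 2) + c * μ)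
    (hq : (g (i + 1) : ℤ) + g (j + 1) = b + g (j + 2) + c' * μ) :
    ∃ l, IsStarter κ μ l := by
  have hmod : ∀ r ≤ 2, (m + i + r) % N = j + r := fun r hr => by
    rcases hij with h | h
    · rw [h, Nat.mod_eq_of_lt (by omega)]
    · rw [h, show j + N + r = j + r + N by ring, Nat.add_mod_right, Nat.mod_eq_of_lt (by omega)]
  have hp' := congrArg (Int.cast : ℤ → ZMod μ) hp
  have hq' := congrArg (Int.cast : ℤ → ZMod μ) hq
  push_cast at hp' hq'
  rw [ZMod.natCast_self] at hp' hq'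
  refine (hg.rotate (i + 1)).exists_isStarter (m := m) (b := (b : ZMod μ)) hκ hμ hN hm0 hm ?_ ?_ ?_
  · rcases hb with rfl | rfl <;> simp
  · have h0 : (N - 1 + (i + 1)) % N = i := by
      rw [show N - 1 + (i + 1) = i + N by omega, Nat.add_mod_right, Nat.mod_eq_of_lt (by omega)]
    have h1 := hmod 0 (by omega)
    have h2 := hmod 1 (by omega)
    have h3 := hmod 2 (by omega)
    simp only [h0, show m - 1 + (i + 1) = m + i + 0 by omega, h1, h3,
      show m + 1 + (i + 1) = m + i + 2 by omega, show m + (i + 1) = m + i + 1 by omega, h2]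
    linear_combination hp'
  · have h2 := hmod 1 (by omega)
    have h3 := hmod 2 (by omega)
    simp only [zero_add, Nat.mod_eq_of_lt hi, h3, h2,
      show m + 1 + (i + 1) = m + i + 2 by omega, show m + (i + 1) = m + i + 1 by omega]
    linear_combination hq'

/-- Two zigzags, one on `[2, s + 1]` and one on `[s + 2, 2 * s - 1]` traversed backwards, with the
two entries where they meet interchanged. -/
def zigzag (s k : ℕ) : ℕ :=
  if k + 1 < s then if k % 2 = 0 then 2 + k / 2 else s + 1 - k / 2
  else if k + 1 = s then s + s / 2 + 1
  else if k = s then s / 2 + 2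
  else if k % 2 = 1 then s + 2 + (2 * s - 3 - k) / 2
  else 2 * s - 1 - (2 * s - 3 - k) / 2

/-- The cyclic differences of `zigzag` modulo `2 * s + 1`. -/
def zigzagDiff (s k : ℕ) : ℕ :=
  if k + 2 < s then if k % 2 = 0 then s - 1 - k else s + 2 + k
  else if k + 2 = s then if s % 2 = 0 then s else s - 2
  else if k + 1 = s then s + 2
  else if k = s then if s % 2 = 0 then s - 2 else s
  else if k + 3 = 2 * s then s + 1
  else if k % 2 = 1 then k + 1 - s
  else 3 * s - k

theorem zigzag_cases {s k : ℕ} (hs : 5 ≤ s) (hk : k < 2 * s - 2) :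
    ∃ x, (k = 2 * x ∧ k + 1 < s ∧ zigzag s k = 2 + x) ∨
      (k = 2 * x + 1 ∧ k + 1 < s ∧ zigzag s k + x = s + 1) ∨
      (k + 1 = s ∧ s / 2 = x ∧ zigzag s k = s + x + 1) ∨
      (k = s ∧ s / 2 = x ∧ zigzag s k = x + 2) ∨
      (k + 2 * x + 3 = 2 * s ∧ s < k ∧ zigzag s k = s + 2 + x) ∨
      (k + 2 * x + 4 = 2 * s ∧ s < k ∧ zigzag s k + x + 1 = 2 * s) := by
  unfold zigzag
  split_ifs
  · exact ⟨k / 2, .inl (by omega)⟩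
  · exact ⟨k / 2, .inr (.inl (by omega))⟩
  · exact ⟨s / 2, .inr (.inr (.inl (by omega)))⟩
  · exact ⟨s / 2, .inr (.inr (.inr (.inl (by omega))))⟩
  · exact ⟨(2 * s - 3 - k) / 2, .inr (.inr (.inr (.inr (.inl (by omega)))))⟩
  · exact ⟨(2 * s - 3 - k) / 2, .inr (.inr (.inr (.inr (.inr (by omega)))))⟩

theorem zigzagDiff_cases {s k : ℕ} (hk : k < 2 * s - 2) :
    (k % 2 = 0 ∧ k + 2 < s ∧ zigzagDiff s k + k + 1 = s) ∨
      (k % 2 = 1 ∧ k + 2 < s ∧ zigzagDiff s k = s + 2 + k) ∨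
      (k + 2 = s ∧ zigzagDiff s k + 2 * (s % 2) = s) ∨
      (k + 1 = s ∧ zigzagDiff s k = s + 2) ∨
      (k = s ∧ zigzagDiff s k + 2 = s + 2 * (s % 2)) ∨
      (k + 3 = 2 * s ∧ zigzagDiff s k = s + 1) ∨
      (k % 2 = 1 ∧ s < k ∧ k + 3 < 2 * s ∧ zigzagDiff s k + s = k + 1) ∨
      (k % 2 = 0 ∧ s < k ∧ k + 3 < 2 * s ∧ zigzagDiff s k + k = 3 * s) := by
  unfold zigzagDiff
  split_ifs
  · exact .inl (by omega)
  · exact .inr (.inl (by omega))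
  · exact .inr (.inr (.inl (by omega)))
  · exact .inr (.inr (.inl (by omega)))
  · exact .inr (.inr (.inr (.inl (by omega))))
  · exact .inr (.inr (.inr (.inr (.inl (by omega)))))
  · exact .inr (.inr (.inr (.inr (.inl (by omega)))))
  · exact .inr (.inr (.inr (.inr (.inr (.inl (by omega))))))
  · exact .inr (.inr (.inr (.inr (.inr (.inr (.inl (by omega)))))))
  · exact .inr (.inr (.inr (.inr (.inr (.inr (.inr (by omega)))))))

theorem zigzag_injOn {s i j : ℕ} (hs : 5 ≤ s) (hi : i < 2 * s - 2) (hj : j < 2 * s - 2)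
    (h : zigzag s i = zigzag s j) : i = j := by
  obtain ⟨x, hx⟩ := zigzag_cases hs hi
  obtain ⟨y, hy⟩ := zigzag_cases hs hj
  rcases hx with hx | hx | hx | hx | hx | hx <;> rcases hy with hy | hy | hy | hy | hy | hy <;>
    omega

theorem zigzagDiff_injOn {s i j : ℕ} (hi : i < 2 * s - 2) (hj : j < 2 * s - 2)
    (h : zigzagDiff s i = zigzagDiff s j) : i = j := by
  rcases zigzagDiff_cases hi with hx | hx | hx | hx | hx | hx | hx | hx <;>
    rcases zigzagDiff_cases hj with hy | hy | hy | hy | hy | hy | hy | hy <;> omega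

theorem zigzag_succ {s k : ℕ} (hs : 5 ≤ s) (hk : k + 1 < 2 * s - 2) :
    zigzag s (k + 1) = zigzag s k + zigzagDiff s k ∨
      zigzag s (k + 1) + (2 * s + 1) = zigzag s k + zigzagDiff s k := by
  obtain ⟨x, hx⟩ := zigzag_cases hs (show k < 2 * s - 2 by omega)
  obtain ⟨y, hy⟩ := zigzag_cases hs hk
  have hd := zigzagDiff_cases (show k < 2 * s - 2 by omega)
  rcases hx with hx | hx | hx | hx | hx | hx <;>
    rcases hy with hy | hy | hy | hy | hy | hy <;> first | (exfalso; clear hd; omega) | skip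
  all_goals rcases hd with hd | hd | hd | hd | hd | hd | hd | hd <;> omega

theorem isMacro_zigzag {s : ℕ} (hs : 5 ≤ s) :
    IsMacro (2 * s + 1) (2 * s - 2) fun k => (zigzag s (k % (2 * s - 2)) : ZMod (2 * s + 1)) := by
  refine isMacro_of_lift (d := zigzagDiff s) (by omega) ?_ ?_ ?_ ?_ ?_
  · intro k hk
    obtain ⟨x, hx⟩ := zigzag_cases hs hk
    omega
  · exact fun i hi j hj => zigzag_injOn hs hi hj
  · intro k hk
    have := zigzagDiff_cases hk
    omega
  · exact fun i hi j hj => zigzagDiff_injOn hi hj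
  · intro k hk
    by_cases h : k + 3 = 2 * s
    · have h1 : zigzag s 0 = 2 := by simp [zigzag, show 1 < s by omega]
      obtain ⟨x, hx⟩ := zigzag_cases hs hk
      have hd := zigzagDiff_cases hk
      rw [show k + 1 = 2 * s - 2 by omega, Nat.mod_self, h1]
      omega
    · rw [Nat.mod_eq_of_lt (by omega)]
      exact zigzag_succ hs (by omega)

end Zigzag

section Existence

theorem exists_isStarter_of_zigzag {s p i j m : ℕ} {b c c' : ℤ} (hs : 5 ≤ s) (hm0 : 0 < m)
    (hm : m + 3 < 2 * s) (hi : i + 3 < 2 * s) (hj : j + 4 < 2 * s)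
    (hij : m + i = j ∨ m + i + 2 = j + 2 * s) (hb : b = 1 ∨ b = -1)
    (hp : (zigzag s i : ℤ) + zigzag s (j + 1) = zigzag s j + zigzag s (j + 2) + c * (2 * s + 1))
    (hq : (zigzag s (i + 1) : ℤ) + zigzag s (j + 1) = b + zigzag s (j + 2) + c' * (2 * s + 1)) :
    ∃ l, IsStarter (2 * p + 5) (2 * s + 1) l :=
  exists_isStarter_of_lift (isMacro_zigzag hs) (i := i) (j := j) (b := b) (c := c) rfl (by omega)
    ⟨s - 1, by omega⟩ hm0 (by omega) (by omega) (by omega) (by omega) hb (by exact_mod_cast hp)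
    (by exact_mod_cast hq)

theorem exists_isStarter_eleven (p : ℕ) : ∃ l, IsStarter (2 * p + 5) 11 l := by
  let g : ℕ → ℕ := fun k => [7, 5, 8, 4, 6, 3, 9, 2].getD k 0
  have hg : IsMacro 11 8 fun k => (g (k % 8) : ZMod 11) :=
    isMacro_of_lift (d := fun k => (g ((k + 1) % 8) + 11 - g k) % 11) (by decide) (by decide)
      (by decide) (by decide) (by decide) (by decide)
  exact exists_isStarter_of_lift hg (i := 0) (j := 5) (m := 5) (b := 1) (c := 1) (c' := 1) rfl rfl
    (by decide) (by decide) (by decide) (by decide) (by decide) (by decide) (by decide) (by decide)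
    (by decide)

theorem exists_isStarter_seventeen (p : ℕ) : ∃ l, IsStarter (2 * p + 5) 17 l := by
  let g : ℕ → ℕ := fun k => [13, 8, 5, 15, 4, 7, 12, 10, 14, 6, 2, 9, 3, 11].getD k 0
  have hg : IsMacro 17 14 fun k => (g (k % 14) : ZMod 17) :=
    isMacro_of_lift (d := fun k => (g ((k + 1) % 14) + 17 - g k) % 17) (by decide) (by decide)
      (by decide) (by decide) (by decide) (by decide)
  exact exists_isStarter_of_lift hg (i := 0) (j := 9) (m := 9) (b := 1) (c := 0) (c' := 0) rfl rfl
    (by decide) (by decide) (by decide) (by decide) (by decide) (by decide) (by decide) (by decide)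
    (by decide)

theorem exists_isStarter_of_eleven_le (p : ℕ) {μ : ℕ} (hodd : Odd μ) (h3 : ¬ 3 ∣ μ) (hμ : 11 ≤ μ) :
    ∃ l, IsStarter (2 * p + 5) μ l := by
  obtain ⟨s, rfl⟩ := hodd
  obtain ⟨n, r, hr, rfl⟩ : ∃ n r, r < 5 ∧ s = 5 * n + r := ⟨s / 5, s % 5, by omega, by omega⟩
  by_cases h11 : 5 * n + r = 5
  · rw [h11]
    exact exists_isStarter_eleven p
  by_cases h17 : 5 * n + r = 8
  · rw [h17]
    exact exists_isStarter_seventeen p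
  interval_cases r
  · obtain ⟨h1, h2, h3, h4, h5⟩ : zigzag (5 * n + 0) (2 * n - 5) = 4 * n + 4 ∧ zigzag (5 * n + 0) (2 * n - 5 + 1) = n ∧
        zigzag (5 * n + 0) (4 * n - 3) = 3 * n + 3 ∧ zigzag (5 * n + 0) (4 * n - 3 + 1) = 2 * n + 1 ∧
        zigzag (5 * n + 0) (4 * n - 3 + 2) = 3 * n + 2 := by
      refine ⟨?_, ?_, ?_, ?_, ?_⟩ <;> unfold zigzag <;> split_ifs <;> omega
    exact exists_isStarter_of_zigzag (i := 2 * n - 5) (j := 4 * n - 3) (m := 2 * n + 2) (b := -1) (c := 0)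
      (c' := 0) (by omega) (by omega) (by omega) (by omega) (by omega) (by omega) (by decide)
      (by rw [h1, h3, h4, h5]; push_cast; ring) (by rw [h2, h4, h5]; push_cast; ring)
  · obtain ⟨h1, h2, h3, h4, h5⟩ : zigzag (5 * n + 1) (6 * n + 2) = 8 * n + 3 ∧ zigzag (5 * n + 1) (6 * n + 2 + 1) = 7 * n + 1 ∧
        zigzag (5 * n + 1) (2 * n - 2) = n + 1 ∧ zigzag (5 * n + 1) (2 * n - 2 + 1) = 4 * n + 3 ∧
        zigzag (5 * n + 1) (2 * n - 2 + 2) = n + 2 := by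
      refine ⟨?_, ?_, ?_, ?_, ?_⟩ <;> unfold zigzag <;> split_ifs <;> omega
    exact exists_isStarter_of_zigzag (i := 6 * n + 2) (j := 2 * n - 2) (m := 6 * n - 4) (b := -1) (c := 1)
      (c' := 1) (by omega) (by omega) (by omega) (by omega) (by omega) (by omega) (by decide)
      (by rw [h1, h3, h4, h5]; push_cast; ring) (by rw [h2, h4, h5]; push_cast; ring)
  · obtain ⟨h1, h2, h3, h4, h5⟩ : zigzag (5 * n + 2) (8 * n + 3) = 6 * n + 3 ∧ zigzag (5 * n + 2) (8 * n + 3 + 1) = 9 * n + 5 ∧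
        zigzag (5 * n + 2) (6 * n + 1) = 7 * n + 4 ∧ zigzag (5 * n + 2) (6 * n + 1 + 1) = 8 * n + 4 ∧
        zigzag (5 * n + 2) (6 * n + 1 + 2) = 7 * n + 3 := by
      refine ⟨?_, ?_, ?_, ?_, ?_⟩ <;> unfold zigzag <;> split_ifs <;> omega
    exact exists_isStarter_of_zigzag (i := 8 * n + 3) (j := 6 * n + 1) (m := 8 * n) (b := 1) (c := 0)
      (c' := 1) (by omega) (by omega) (by omega) (by omega) (by omega) (by omega) (by decide)
      (by rw [h1, h3, h4, h5]; push_cast; ring) (by rw [h2, h4, h5]; push_cast; ring)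
  · obtain ⟨h1, h2, h3, h4, h5⟩ : zigzag (5 * n + 3) (6 * n + 2) = 8 * n + 5 ∧ zigzag (5 * n + 3) (6 * n + 2 + 1) = 7 * n + 5 ∧
        zigzag (5 * n + 3) (2 * n - 2) = n + 1 ∧ zigzag (5 * n + 3) (2 * n - 2 + 1) = 4 * n + 5 ∧
        zigzag (5 * n + 3) (2 * n - 2 + 2) = n + 2 := by
      refine ⟨?_, ?_, ?_, ?_, ?_⟩ <;> unfold zigzag <;> split_ifs <;> omega
    exact exists_isStarter_of_zigzag (i := 6 * n + 2) (j := 2 * n - 2) (m := 6 * n) (b := 1) (c := 1)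
      (c' := 1) (by omega) (by omega) (by omega) (by omega) (by omega) (by omega) (by decide)
      (by rw [h1, h3, h4, h5]; push_cast; ring) (by rw [h2, h4, h5]; push_cast; ring)
  · obtain ⟨h1, h2, h3, h4, h5⟩ : zigzag (5 * n + 4) (2 * n - 1) = 4 * n + 6 ∧ zigzag (5 * n + 4) (2 * n - 1 + 1) = n + 2 ∧
        zigzag (5 * n + 4) (4 * n + 1) = 3 * n + 5 ∧ zigzag (5 * n + 4) (4 * n + 1 + 1) = 2 * n + 3 ∧
        zigzag (5 * n + 4) (4 * n + 1 + 2) = 3 * n + 4 := by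
      refine ⟨?_, ?_, ?_, ?_, ?_⟩ <;> unfold zigzag <;> split_ifs <;> omega
    exact exists_isStarter_of_zigzag (i := 2 * n - 1) (j := 4 * n + 1) (m := 2 * n + 2) (b := 1) (c := 0)
      (c' := 0) (by omega) (by omega) (by omega) (by omega) (by omega) (by omega) (by decide)
      (by rw [h1, h3, h4, h5]; push_cast; ring) (by rw [h2, h4, h5]; push_cast; ring)

end Existence

section Small

theorem isStarter_five_five : IsStarter 5 5
    [(4, 2), (3, 2), (3, 4), (1, 0), (2, 4), (1, 2), (4, 4), (2, 0), (1, 1), (2, 3), (3, 3),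
      (0, 3), (0, 1), (4, 3), (2, 1), (3, 0), (4, 1), (1, 3), (3, 1), (4, 0), (0, 4), (0, 0),
      (1, 4), (2, 2), (0, 2)] where
  nodup := by decide +kernel
  length := by decide +kernel
  classes := by decide +kernel
  admissible := by decide +kernel

theorem isStarter_five_seven : IsStarter 5 7
    [(4, 2), (2, 4), (0, 2), (2, 5), (2, 2), (4, 4), (3, 4), (2, 1), (3, 0), (0, 6), (0, 0),
      (4, 1), (4, 3), (0, 3), (2, 3), (1, 6), (2, 0), (4, 6), (0, 4), (3, 1), (1, 0), (1, 1),
      (3, 5), (1, 5), (1, 3), (0, 5), (1, 2), (4, 5), (3, 3), (0, 1), (1, 4), (2, 6), (4, 0),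
      (3, 6), (3, 2)] where
  nodup := by decide +kernel
  length := by decide +kernel
  classes := by decide +kernel
  admissible := by decide +kernel

theorem isStarter_seven_seven : IsStarter 7 7
    [(4, 6), (1, 0), (6, 6), (0, 4), (2, 2), (3, 5), (3, 2), (3, 4), (0, 1), (5, 3), (6, 3),
      (2, 5), (4, 2), (6, 5), (4, 5), (0, 3), (2, 3), (1, 6), (6, 0), (5, 1), (1, 4), (4, 4),
      (1, 2), (0, 2), (2, 4), (6, 4), (5, 2), (5, 5), (3, 3), (0, 5), (4, 1), (2, 0), (0, 6),
      (3, 0), (5, 6), (1, 3), (1, 1), (4, 0), (2, 1), (1, 5), (6, 2), (5, 4), (6, 1), (5, 0),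
      (3, 1), (4, 3), (2, 6), (0, 0), (3, 6)] where
  nodup := by decide +kernel
  length := by decide +kernel
  classes := by decide +kernel
  admissible := by decide +kernel

/-- A row-complete Latin square of order `9`: the translates of three rows by `ZMod 3 × {0}`. -/
def squareNine (i : ZMod 3 × ZMod 3) (j : Fin 9) : ZMod 3 × ZMod 3 :=
  (![![(0, 0), (2, 2), (1, 1), (1, 0), (1, 2), (2, 1), (0, 2), (2, 0), (0, 1)],
    ![(0, 1), (2, 0), (0, 0), (2, 1), (1, 1), (1, 2), (1, 0), (2, 2), (0, 2)],
    ![(0, 2), (0, 1), (2, 2), (1, 2), (2, 0), (1, 0), (1, 1), (2, 1), (0, 0)]] : Fin 3 → Fin 9 → _)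
    i.1 j + (i.2, 0)

theorem isRowComplete_squareNine : IsRowComplete squareNine where
  row := by decide +kernel
  col := by decide +kernel
  pair := by decide +kernel

end Small

theorem exists_isStarter_of_five_le {κ μ : ℕ} (hκ : Odd κ) (hμ : Odd μ) (h3 : ¬ 3 ∣ κ * μ)
    (h5 : 5 ≤ κ) (hle : κ ≤ μ) : ∃ l, IsStarter κ μ l := by
  have h3κ : ¬ 3 ∣ κ := fun h => h3 (h.mul_right _)
  have h3μ : ¬ 3 ∣ μ := fun h => h3 (h.mul_left _)
  obtain ⟨x, rfl⟩ := hκ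
  by_cases h11 : 11 ≤ μ
  · obtain ⟨p, rfl⟩ : ∃ p, x = p + 2 := ⟨x - 2, by omega⟩
    exact exists_isStarter_of_eleven_le p hμ h3μ h11
  · obtain ⟨y, rfl⟩ := hμ
    have hx : x = 2 ∨ x = 3 := by omega
    have hy : y = 2 ∨ y = 3 := by omega
    rcases hx with rfl | rfl <;> rcases hy with rfl | rfl
    · exact ⟨_, isStarter_five_five⟩
    · exact ⟨_, isStarter_five_seven⟩
    · omega
    · exact ⟨_, isStarter_seven_seven⟩

theorem roman_design_composite (t : ℕ) (ht : 4 ≤ t) (hcomp : ¬ Nat.Prime t)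
    (ℓ : ℕ) (hℓ : 0 < ℓ) :
    ∃ D : Fin (ℓ * t) → Fin t → Fin t, IsRomanDesign (ℓ * t) t 1 D := by
  rcases Nat.even_or_odd t with heven | hodd
  · have : NeZero t := ⟨by omega⟩
    obtain ⟨L, hL⟩ := exists_isRowComplete_of_even (by omega) heven
    exact hL.exists_isRomanDesign_of_card (ZMod.card t) (ZMod.card t) (by omega) ℓ
  by_cases h3 : 3 ∣ t
  · obtain ⟨κ, rfl⟩ := h3
    obtain ⟨x, rfl⟩ := (Nat.odd_mul.1 hodd).2
    by_cases hx : x = 1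
    · subst hx
      exact isRowComplete_squareNine.exists_isRomanDesign_of_card (by simp [ZMod.card])
        (by simp [ZMod.card]) (by omega) ℓ
    · obtain ⟨p, rfl⟩ : ∃ p, x = p + 2 := ⟨x - 2, by omega⟩
      rw [mul_comm 3]
      exact (isStarter_apexPoint p).exists_isRomanDesign ℓ
  · obtain ⟨μ, hμ⟩ := t.minFac_dvd
    have hle : t.minFac ≤ μ := by
      have h1 := Nat.minFac_sq_le_self (by omega) hcomp
      rw [sq] at h1
      exact Nat.le_of_mul_le_mul_left (h1.trans_eq hμ) t.minFac_pos
    have hprime := Nat.minFac_prime (n := t) (by omega)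
    have hodd' := hodd
    rw [hμ, Nat.odd_mul] at hodd'
    have h5 : 5 ≤ t.minFac := by
      have h2 := hprime.two_le
      have h4 : t.minFac ≠ 3 := fun h => h3 (h ▸ t.minFac_dvd)
      obtain ⟨x, hx⟩ := hodd'.1
      omega
    have : NeZero t.minFac := ⟨by omega⟩
    have : NeZero μ := ⟨by omega⟩
    obtain ⟨l, hl⟩ := exists_isStarter_of_five_le hodd'.1 hodd'.2 (by rwa [← hμ]) h5 hle
    have h := hl.exists_isRomanDesign ℓ
    rwa [← hμ] at h
end

section
/- Let G be a finite abelian group of order t ≥ 3 with an element of order greater than 2 (so that inversion is an automorphism of order 2). If a is a terrace for G, i.e., a Roman-1 pseudoterrace with respect to the inversion automorphism x ↦ −x, then the pair consisting of a and the reverse of a (the ordering j ↦ a(t − 1 − j)) is a Roman-1 2-tuple (Roman pair) for G. -/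
/-- The index at which the step leaving position `j` of an ordering (`r = 0`) or of its reverse
(`r = 1`) is read in the original ordering. -/
def stepIndex {t : ℕ} (r : Fin 2) (j : Fin t) : Fin t :=
  if r = 0 then j else ⟨t - 2 - (j : ℕ), by omega⟩

theorem stepIndex_spec {G : Type*} [AddCommGroup G] {t : ℕ} (a : Fin t → G) {g : G}
    {r : Fin 2} {j : Fin t}
    (hp : ∃ h : (j : ℕ) + 1 < t,
      (![a, fun i => a ⟨t - 1 - (i : ℕ), by omega⟩] : Fin 2 → Fin t → G) r ⟨(j : ℕ) + 1, h⟩ -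
      (![a, fun i => a ⟨t - 1 - (i : ℕ), by omega⟩] : Fin 2 → Fin t → G) r j = g) :
    ∃ h : (stepIndex r j : ℕ) + 1 < t,
      a ⟨(stepIndex r j : ℕ) + 1, h⟩ - a (stepIndex r j) = if r = 0 then g else -g := by
  obtain ⟨h, e⟩ := hp
  fin_cases r
  · exact ⟨h, e⟩
  · have e' : a ⟨t - 1 - ((j : ℕ) + 1), by omega⟩ - a ⟨t - 1 - (j : ℕ), by omega⟩ = g := e
    refine ⟨show t - 2 - (j : ℕ) + 1 < t by omega, ?_⟩
    change a ⟨t - 2 - (j : ℕ) + 1, _⟩ - a ⟨t - 2 - (j : ℕ), _⟩ = -g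
    rw [← e', neg_sub]
    congr 3 <;> omega

theorem stepIndex_inj {t : ℕ} {r : Fin 2} {i j : Fin t} (hi : (i : ℕ) + 1 < t)
    (hj : (j : ℕ) + 1 < t) (h : stepIndex r i = stepIndex r j) : i = j := by
  unfold stepIndex at h
  split_ifs at h
  · exact h
  · simp only [Fin.mk.injEq] at h
    omega


/-- A Roman-`k` `ℓ`-tuple for an additive group `G` of order `t`. -/
def IsAddRomanTuple (G : Type*) [AddGroup G] (t k ℓ : ℕ)
    (a : Fin ℓ → Fin t → G) : Prop :=
  (∀ r : Fin ℓ, Function.Bijective (a r)) ∧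
  ∀ d : ℕ, 1 ≤ d → d ≤ k → ∀ g : G, g ≠ 0 →
    Nat.card {p : Fin ℓ × Fin t //
      ∃ h : (p.2 : ℕ) + d < t, a p.1 ⟨(p.2 : ℕ) + d, h⟩ - a p.1 p.2 = g} ≤ ℓ

/-- A terrace for an additive abelian group `G` of order `t`: a Roman-1 pseudoterrace
with respect to the inversion automorphism `x ↦ -x`, whose orbit of `g` is `{g, -g}`. -/
def IsTerrace {G : Type*} [AddCommGroup G] (t : ℕ) (a : Fin t → G) : Prop :=
  Function.Bijective a ∧
  ∀ g : G, g ≠ 0 →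
    Nat.card {j : Fin t //
        ∃ h : (j : ℕ) + 1 < t, a ⟨(j : ℕ) + 1, h⟩ - a j ∈ ({g, -g} : Set G)}
      ≤ Nat.card ({g, -g} : Set G)

theorem roman_pair_of_terrace {G : Type*} [AddCommGroup G] [Fintype G]
    (t : ℕ) (ht : Fintype.card G = t) (ht3 : 3 ≤ t)
    (hbig : ∃ x : G, 2 < addOrderOf x)
    (a : Fin t → G) (ha : IsTerrace t a) :
    IsAddRomanTuple G t 1 2 ![a, fun j => a ⟨t - 1 - (j : ℕ), by omega⟩] := by
  obtain ⟨hbij, hstep⟩ := ha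
  refine ⟨fun r => ?_, fun d hd1 hd2 g hg => ?_⟩
  · fin_cases r
    · exact hbij
    · have hrev : (fun j : Fin t => a ⟨t - 1 - (j : ℕ), by omega⟩) = a ∘ Fin.rev := by
        funext j
        simp only [Function.comp_apply]
        congr 1
        ext
        simp only [Fin.val_rev]
        omega
      change Function.Bijective (fun j : Fin t => a ⟨t - 1 - (j : ℕ), by omega⟩)
      rw [hrev]
      exact hbij.comp Fin.rev_bijective
  · obtain rfl : d = 1 := le_antisymm hd2 hd1
    have hS := hstep g hg
    set S := {j : Fin t //
      ∃ h : (j : ℕ) + 1 < t, a ⟨(j : ℕ) + 1, h⟩ - a j ∈ ({g, -g} : Set G)}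
    set P := {p : Fin 2 × Fin t // ∃ h : (p.2 : ℕ) + 1 < t,
      (![a, fun i => a ⟨t - 1 - (i : ℕ), by omega⟩] : Fin 2 → Fin t → G) p.1 ⟨(p.2 : ℕ) + 1, h⟩ -
      (![a, fun i => a ⟨t - 1 - (i : ℕ), by omega⟩] : Fin 2 → Fin t → G) p.1 p.2 = g}
    let φ : P → S := fun p => ⟨stepIndex p.1.1 p.1.2, by
      obtain ⟨h, e⟩ := stepIndex_spec a p.2
      refine ⟨h, ?_⟩
      rw [e]
      split_ifs <;> simp⟩
    have hφ (p q : P) (hr : p.1.1 = q.1.1) (h : φ p = φ q) : p = q := by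
      have h' : stepIndex p.1.1 p.1.2 = stepIndex q.1.1 q.1.2 := congrArg Subtype.val h
      rw [hr] at h'
      exact Subtype.ext (Prod.ext hr (stepIndex_inj p.2.1 q.2.1 h'))
    by_cases hgg : g = -g
    · have hinj : Function.Injective fun p : P => (p.1.1, φ p) := fun p q h =>
        hφ p q (Prod.ext_iff.1 h).1 (Prod.ext_iff.1 h).2
      have hle := Nat.card_le_card_of_injective _ hinj
      rw [← hgg, Set.pair_eq_singleton, Nat.card_coe_set_eq, Set.ncard_singleton] at hS
      rw [Nat.card_prod, Nat.card_fin] at hle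
      omega
    · have hinj : Function.Injective φ := by
        refine fun p q h => hφ p q ?_ h
        obtain ⟨_, ep⟩ := stepIndex_spec a p.2
        obtain ⟨_, eq⟩ := stepIndex_spec a q.2
        have h' : stepIndex p.1.1 p.1.2 = stepIndex q.1.1 q.1.2 := congrArg Subtype.val h
        simp only [h'] at ep
        rw [ep] at eq
        split_ifs at eq with hp hq hq
        · rw [hp, hq]
        · exact absurd eq hgg
        · exact absurd eq.symm hgg
        · omega
      refine (Nat.card_le_card_of_injective _ hinj).trans (hS.trans ?_)
      rw [Nat.card_coe_set_eq]
      exact (Set.ncard_pair hgg).le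
end
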